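/- Let u ∈ P_∞⁺(0,M) satisfy u ≥ 0 in ℝ₊ⁿ, and suppose u is differentiable at every point of Π with ∇u(0,x₂,…,xₙ) = 0 for all (x₂,…,xₙ). Then Λ(u) = Π, i.e. the coincidence set {x in the closed half-space : u(x) = |∇u(x)| = 0} equals the hyperplane {x₁ = 0}. (Theorem B: classification of nonnegative global solutions.) -/

import Mathlib

open Metric Set MeasureTheory Filter

noncomputable section

attribute [local instance] Matrix.normedAddCommGroup Matrix.normedSpace

/-- Euclidean space ℝⁿ. -/
abbrev En (n : ℕ) := EuclideanSpace ℝ (Fin n)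

/-- The open half-space `{x : x₁ > 0}`. -/
def HplusSet (n : ℕ) [NeZero n] : Set (En n) := {x | 0 < x 0}

/-- The closed half-space `{x : x₁ ≥ 0}`. -/
def HcloSet (n : ℕ) [NeZero n] : Set (En n) := {x | 0 ≤ x 0}

/-- The hyperplane `Π = {x : x₁ = 0}`. -/
def PiSet (n : ℕ) [NeZero n] : Set (En n) := {x | x 0 = 0}

/-- The half-ball `B⁺(z,r)`. -/
def Bplus (n : ℕ) [NeZero n] (z : En n) (r : ℝ) : Set (En n) := HplusSet n ∩ ball z r

/-- Operator norm of a matrix acting on Euclidean space. -/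
def matOpNorm {n : ℕ} (N : Matrix (Fin n) (Fin n) ℝ) : ℝ :=
  ‖(Matrix.toEuclideanCLM (𝕜 := ℝ) N : EuclideanSpace ℝ (Fin n) →L[ℝ] EuclideanSpace ℝ (Fin n))‖

/-- The structural assumptions on the fully nonlinear operator `F`:
uniform ellipticity with constants `0 < lam ≤ Lam`, positive one-homogeneity,
convexity (on symmetric matrices) and `C¹` smoothness. -/
structure EllipticF (n : ℕ) (lam Lam : ℝ) (F : Matrix (Fin n) (Fin n) ℝ → ℝ) : Prop where
  lam_pos : 0 < lam
  lam_le_Lam : lam ≤ Lam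
  elliptic_lower : ∀ A N : Matrix (Fin n) (Fin n) ℝ, A.IsSymm → N.PosSemidef →
    lam * matOpNorm N ≤ F (A + N) - F A
  elliptic_upper : ∀ A N : Matrix (Fin n) (Fin n) ℝ, A.IsSymm → N.PosSemidef →
    F (A + N) - F A ≤ Lam * matOpNorm N
  homogeneous : ∀ (t : ℝ) (A : Matrix (Fin n) (Fin n) ℝ), F (t • A) = t * F A
  convexF : ConvexOn ℝ {A : Matrix (Fin n) (Fin n) ℝ | A.IsSymm} F
  smoothF : ContDiff ℝ 1 F

/-- The quadratic polynomial `x ↦ c + b·x + ½ xᵀAx`. -/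
def quadPoly {n : ℕ} (c : ℝ) (b : En n) (A : Matrix (Fin n) (Fin n) ℝ) (x : En n) : ℝ :=
  c + ∑ i, b i * x i + (1 / 2) * ∑ i, ∑ j, A i j * x i * x j

/-- `u` is a viscosity solution of `F(D²u) = g` in the open set `D`. -/
def ViscositySol {n : ℕ} (F : Matrix (Fin n) (Fin n) ℝ → ℝ) (g : En n → ℝ) (D : Set (En n))
    (u : En n → ℝ) : Prop :=
  ∀ x₀ ∈ D,
    (∀ (c : ℝ) (b : En n) (A : Matrix (Fin n) (Fin n) ℝ), A.IsSymm →
      IsLocalMaxOn (fun x => u x - quadPoly c b A x) D x₀ → g x₀ ≤ F A) ∧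
    (∀ (c : ℝ) (b : En n) (A : Matrix (Fin n) (Fin n) ℝ), A.IsSymm →
      IsLocalMinOn (fun x => u x - quadPoly c b A x) D x₀ → F A ≤ g x₀)

/-- Membership in the class `P_r⁺(z,M)` of local solutions, with associated open set `Ω`. -/
structure MemPplus {n : ℕ} [NeZero n] (F : Matrix (Fin n) (Fin n) ℝ → ℝ) (z : En n) (r M : ℝ)
    (u : En n → ℝ) (Ω : Set (En n)) : Prop where
  cont : ContinuousOn u (closure (Bplus n z r))
  Ω_open : IsOpen Ω
  Ω_sub : Ω ⊆ HplusSet n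
  sol : ViscositySol F (Ω.indicator fun _ => (1 : ℝ)) (Bplus n z r) u
  vanish : ∀ x ∈ Bplus n z r \ Ω, u x = 0 ∧ HasGradientAt u 0 x
  bdd : ∀ x ∈ Bplus n z r, |u x| ≤ M
  bdry_zero : ∀ x ∈ PiSet n ∩ ball (0 : En n) 1, u x = 0
  z_bdry : z ∈ frontier Ω

/-- Membership in the class `P_∞⁺(0,M)` of global solutions, with associated open set `Ω`. -/
structure MemPinf {n : ℕ} [NeZero n] (F : Matrix (Fin n) (Fin n) ℝ → ℝ) (M : ℝ)
    (u : En n → ℝ) (Ω : Set (En n)) : Prop where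
  cont : ContinuousOn u (HcloSet n)
  Ω_open : IsOpen Ω
  Ω_sub : Ω ⊆ HplusSet n
  sol : ViscositySol F (Ω.indicator fun _ => (1 : ℝ)) (HplusSet n) u
  vanish : ∀ x ∈ HplusSet n \ Ω, u x = 0 ∧ HasGradientAt u 0 x
  growth : ∀ x, |u x| ≤ M * (‖x‖ ^ 2 + 1)
  bdry_zero : ∀ x ∈ PiSet n, u x = 0
  zero_bdry : (0 : En n) ∈ frontier Ω

/-- The density `V_r(z,u) = vol(Ω⁻(u) ∩ B⁺(z,r)) / rⁿ`. -/
def Vr {n : ℕ} [NeZero n] (u : En n → ℝ) (Ω : Set (En n)) (z : En n) (r : ℝ) : ℝ :=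
  (volume ({x ∈ Ω | u x < 0} ∩ Bplus n z r)).toReal / r ^ n

/-- A modulus of continuity: nonnegative, nondecreasing on `(0,∞)` and tending to `0` at `0⁺`. -/
def IsModulus (σ : ℝ → ℝ) : Prop :=
  (∀ r : ℝ, 0 < r → 0 ≤ σ r) ∧ (∀ ⦃r s : ℝ⦄, 0 < r → r ≤ s → σ r ≤ σ s) ∧
    Tendsto σ (nhdsWithin 0 (Ioi 0)) (nhds 0)


set_option linter.all false

abbrev MPol (n : ℕ) := MvPolynomial (Fin n) ℝ

abbrev ev {n : ℕ} (p : MPol n) (x : En n) : ℝ := MvPolynomial.eval x.ofLp p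

open MvPolynomial in
theorem pd_comm {n : ℕ} (i j : Fin n) (p : MPol n) :
    pderiv i (pderiv j p) = pderiv j (pderiv i p) := by
  induction p using MvPolynomial.induction_on with
  | C a => simp
  | add p q hp hq => simp [hp, hq]
  | mul_X p k hp =>
    simp only [pderiv_mul, map_add, pderiv_X, hp]
    have : ∀ a b : Fin n, pderiv a ((Pi.single b (1 : MPol n) : Fin n → MPol n) k) = 0 := by
      intro a b
      by_cases h : k = b
      · subst h; simp
      · simp [Pi.single_apply, h]
    rw [this, this]
    ring

def T2 {n : ℕ} (p : MPol n) (x₀ x : En n) : ℝ :=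
  ev p x₀ + ∑ i, ev (MvPolynomial.pderiv i p) x₀ * (x i - x₀ i) +
    (1 / 2) * ∑ i, ∑ j, ev (MvPolynomial.pderiv i (MvPolynomial.pderiv j p)) x₀ *
      (x i - x₀ i) * (x j - x₀ j)

theorem coord_isBigO {n : ℕ} (x₀ : En n) (i : Fin n) :
    (fun x : En n => x i - x₀ i) =O[nhds x₀] fun x => ‖x - x₀‖ := by
  refine Asymptotics.IsBigO.of_bound 1 (Eventually.of_forall fun x => ?_)
  have := PiLp.norm_apply_le (x - x₀) i
  simpa using this

theorem coord_isLittleO {n : ℕ} (x₀ : En n) (i : Fin n) :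
    (fun x : En n => x i - x₀ i) =o[nhds x₀] fun _ => (1 : ℝ) := by
  rw [Asymptotics.isLittleO_one_iff]
  have : Continuous fun x : En n => x i - x₀ i := by fun_prop
  simpa using this.tendsto x₀

open MvPolynomial in
theorem taylor2 {n : ℕ} (p : MPol n) (x₀ : En n) :
    (fun x => ev p x - T2 p x₀ x) =o[nhds x₀] fun x => ‖x - x₀‖ ^ 2 := by
  induction p using MvPolynomial.induction_on with
  | C a => simp [T2]
  | add p q hp hq =>
    refine (hp.add hq).congr_left fun x => ?_
    simp only [T2, map_add, add_mul, Finset.sum_add_distrib]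
    ring
  | mul_X p k hp =>
    have h1 : (fun x : En n => (ev p x - T2 p x₀ x) * x k) =o[nhds x₀] fun x => ‖x - x₀‖ ^ 2 := by
      have hc : (fun x : En n => x k) =O[nhds x₀] fun _ => (1 : ℝ) := by
        have : Continuous fun x : En n => x k := by fun_prop
        exact (this.tendsto x₀).isBigO_one ℝ
      simpa using hp.mul_isBigO hc
    have h2 : (fun x : En n => (1 / 2) * (∑ i, ∑ j, ev (pderiv i (pderiv j p)) x₀ *
        (x i - x₀ i) * (x j - x₀ j)) * (x k - x₀ k)) =o[nhds x₀] fun x => ‖x - x₀‖ ^ 2 := by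
      have hb : (fun x : En n => (1 / 2) * (∑ i, ∑ j, ev (pderiv i (pderiv j p)) x₀ *
        (x i - x₀ i) * (x j - x₀ j))) =O[nhds x₀] fun x => ‖x - x₀‖ ^ 2 := by
        refine Asymptotics.IsBigO.const_mul_left ?_ _
        refine Asymptotics.IsBigO.fun_sum fun i _ => ?_
        refine Asymptotics.IsBigO.fun_sum fun j _ => ?_
        have := ((coord_isBigO x₀ i).const_mul_left (ev (pderiv i (pderiv j p)) x₀)).mul
          (coord_isBigO x₀ j)
        simpa [pow_two] using this
      simpa using hb.mul_isLittleO (coord_isLittleO x₀ k)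
    refine (h1.add h2).congr_left fun x => ?_
    have e1 : ∀ i, ev (pderiv i (p * X k)) x₀ =
        ev (pderiv i p) x₀ * x₀ k + (if k = i then ev p x₀ else 0) := by
      intro i
      by_cases h : k = i
      · subst h; simp [pderiv_mul]; ring
      · simp [pderiv_mul, h, pderiv_X_of_ne h]; ring
    have e2 : ∀ i j, ev (pderiv i (pderiv j (p * X k))) x₀ =
        ev (pderiv i (pderiv j p)) x₀ * x₀ k + (if k = i then ev (pderiv j p) x₀ else 0)
        + (if k = j then ev (pderiv i p) x₀ else 0) := by
      intro i j
      by_cases h : k = i <;> by_cases h' : k = j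
      · subst h; subst h'; simp [pderiv_mul]; ring
      · subst h; simp [pderiv_mul, h', pderiv_X_of_ne h']; ring
      · subst h'; simp [pderiv_mul, h, pderiv_X_of_ne h]; ring
      · simp [pderiv_mul, h, pderiv_X_of_ne h, h', pderiv_X_of_ne h']; ring
    simp only [T2, e1, e2, add_mul, Finset.sum_add_distrib, ite_mul, zero_mul,
      Finset.sum_ite_eq, Finset.mem_univ, if_true]
    have e3 : ∀ f : Fin n → ℝ, ∑ x_1, (∑ x_2, if k = x_1 then f x_2 else 0)
        = ∑ j, f j := by
      intro f
      rw [Finset.sum_comm]; simp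
    have e4 : ∀ i j, (if k = i then ev (pderiv j p) x₀ * (x i - x₀ i) * (x j - x₀ j) else 0) =
       if k = i then ev (pderiv j p) x₀ * (x k - x₀ k) * (x j - x₀ j) else 0 := by
      intro i j; split_ifs with h
      · rw [h]
      · rfl
    simp only [e4, e3]
    have e5 : ∑ j, ev (pderiv j p) x₀ * (x k - x₀ k) * (x j - x₀ j) =
      (x k - x₀ k) * ∑ j, ev (pderiv j p) x₀ * (x j - x₀ j) := by
      rw [Finset.mul_sum]; congr 1; ext; ring
    have e6 : ∑ i, ev (pderiv i p) x₀ * (x i - x₀ i) * (x k - x₀ k) =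
      (x k - x₀ k) * ∑ j, ev (pderiv j p) x₀ * (x j - x₀ j) := by
      rw [Finset.mul_sum]; congr 1; ext; ring
    have e7 : ∑ i, ev (pderiv i p) x₀ * x₀ k * (x i - x₀ i) =
      x₀ k * ∑ j, ev (pderiv j p) x₀ * (x j - x₀ j) := by
      rw [Finset.mul_sum]; congr 1; ext; ring
    have e8 : ∑ i, ∑ j, ev (pderiv i (pderiv j p)) x₀ * x₀ k * (x i - x₀ i) * (x j - x₀ j) =
      x₀ k * ∑ i, ∑ j, ev (pderiv i (pderiv j p)) x₀ * (x i - x₀ i) * (x j - x₀ j) := by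
      simp only [Finset.mul_sum]; congr 1; ext; congr 1; ext; ring
    rw [e5, e6, e7, e8]
    simp only [ev, map_mul, eval_X]
    ring

structure EllB (n : ℕ) (B : Fin n → Fin n → ℝ) (lam : ℝ) : Prop where
  symm : ∀ i j, B i j = B j i
  pos : 0 < lam
  coer : ∀ v : Fin n → ℝ, lam * ∑ i, v i ^ 2 ≤ ∑ i, ∑ j, B i j * (v i * v j)
  mono : ∀ A : Matrix (Fin n) (Fin n) ℝ, A.PosSemidef → 0 ≤ ∑ i, ∑ j, B i j * A i j

def Lop {n : ℕ} (B : Fin n → Fin n → ℝ) : MPol n →ₗ[ℝ] MPol n :=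
  ∑ i, ∑ j, B i j • ((MvPolynomial.pderiv i).toLinearMap ∘ₗ (MvPolynomial.pderiv j).toLinearMap)

theorem ev_Lop {n : ℕ} (B : Fin n → Fin n → ℝ) (p : MPol n) (x : En n) :
    ev (Lop B p) x = ∑ i, ∑ j, B i j *
      ev (MvPolynomial.pderiv i (MvPolynomial.pderiv j p)) x := by
  simp [Lop, LinearMap.sum_apply, map_sum, MvPolynomial.smul_eval]

def SubAt {n : ℕ} (B : Fin n → Fin n → ℝ) (v : En n → ℝ) (κ : ℝ) (x₀ : En n) : Prop :=
  ∀ (c : ℝ) (b : En n) (A : Matrix (Fin n) (Fin n) ℝ), A.IsSymm →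
      IsLocalMax (fun x => v x - quadPoly c b A x) x₀ → κ ≤ ∑ i, ∑ j, B i j * A i j

theorem quad_repr {n : ℕ} (x₀ : En n) (c : ℝ) (g : Fin n → ℝ) (A : Matrix (Fin n) (Fin n) ℝ)
    (hA : A.IsSymm) : ∃ (c' : ℝ) (b : En n), ∀ x : En n, quadPoly c' b A x =
      c + ∑ i, g i * (x i - x₀ i) + (1 / 2) * ∑ i, ∑ j, A i j * (x i - x₀ i) * (x j - x₀ j) := by
  refine ⟨c - ∑ i, g i * x₀ i + (1 / 2) * ∑ i, ∑ j, A i j * x₀ i * x₀ j,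
    WithLp.toLp 2 fun i => g i - ∑ j, A i j * x₀ j, fun x => ?_⟩
  simp only [quadPoly]
  have e1 : ∑ i, ∑ j, A i j * (x i - x₀ i) * (x j - x₀ j) =
     ∑ i, ∑ j, A i j * x i * x j - 2 * ∑ i, ∑ j, A i j * x₀ j * x i
      + ∑ i, ∑ j, A i j * x₀ i * x₀ j := by
    have : ∑ i, ∑ j, A i j * x₀ i * x j = ∑ i, ∑ j, A i j * x₀ j * x i := by
      rw [Finset.sum_comm]
      refine Finset.sum_congr rfl fun i _ => Finset.sum_congr rfl fun j _ => ?_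
      rw [hA.apply]
    rw [two_mul]
    nth_rewrite 1 [← this]
    simp only [← Finset.sum_add_distrib, ← Finset.sum_sub_distrib]
    refine Finset.sum_congr rfl fun i _ => Finset.sum_congr rfl fun j _ => ?_
    ring
  rw [e1]
  simp only [mul_sub, sub_mul, Finset.sum_sub_distrib, Finset.sum_mul]
  ring

theorem trB_pos {n : ℕ} [NeZero n] {B : Fin n → Fin n → ℝ} {lam : ℝ} (hB : EllB n B lam) (i : Fin n) :
    0 < B i i := by
  have := hB.coer (Pi.single i 1)
  simp [Pi.single_apply, ite_pow] at this
  linarith [hB.pos]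

theorem tr_pos {n : ℕ} [NeZero n] {B : Fin n → Fin n → ℝ} {lam : ℝ} (hB : EllB n B lam) :
    0 < ∑ i, B i i :=
  Finset.sum_pos (fun i _ => trB_pos hB i) ⟨0, Finset.mem_univ _⟩

theorem nsq {n : ℕ} (x : En n) : ‖x‖ ^ 2 = ∑ i, x i ^ 2 := by
  rw [EuclideanSpace.norm_sq_eq]; simp

theorem touch {n : ℕ} [NeZero n] {B : Fin n → Fin n → ℝ} {lam : ℝ} (hB : EllB n B lam)
    {v : En n → ℝ} {κ : ℝ} {x₀ : En n} (hv : SubAt B v κ x₀) (p : MPol n)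
    (hmax : IsLocalMax (fun x => v x - ev p x) x₀) : κ ≤ ev (Lop B p) x₀ := by
  have key : ∀ δ > 0, κ ≤ ev (Lop B p) x₀ + δ * ∑ i, B i i := by
    intro δ hδ
    set A : Matrix (Fin n) (Fin n) ℝ := fun i j =>
      ev (MvPolynomial.pderiv i (MvPolynomial.pderiv j p)) x₀ + if i = j then δ else 0 with hA
    have hs : A.IsSymm := by
      refine Matrix.IsSymm.ext fun i j => ?_
      simp only [hA]
      rw [pd_comm i j]
      simp [eq_comm]
    obtain ⟨c, b, hQ⟩ := quad_repr x₀ (ev p x₀) (fun i => ev (MvPolynomial.pderiv i p) x₀) A hs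
    have hQ' : ∀ x, quadPoly c b A x = T2 p x₀ x + δ / 2 * ‖x - x₀‖ ^ 2 := by
      intro x
      rw [hQ, nsq, T2]
      simp only [hA, add_mul, Finset.sum_add_distrib, ite_mul, zero_mul, Finset.sum_ite_eq,
        Finset.mem_univ, if_true, PiLp.sub_apply]
      have : ∑ i, δ * (x i - x₀ i) * (x i - x₀ i) = δ * ∑ i, (x i - x₀ i) ^ 2 := by
        rw [Finset.mul_sum]; congr 1; ext; ring
      rw [this]; ring
    have hm : IsLocalMax (fun x => v x - quadPoly c b A x) x₀ := by
      have ht := (taylor2 p x₀).bound (show (0:ℝ) < δ / 2 by positivity)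
      filter_upwards [ht, hmax] with x h1 h2
      rw [hQ', hQ']
      have h3 : T2 p x₀ x₀ = ev p x₀ := by simp [T2]
      rw [h3]
      simp only [sub_self, norm_zero]
      rw [Real.norm_eq_abs, Real.norm_eq_abs, abs_of_nonneg (sq_nonneg ‖x - x₀‖)] at h1
      have := (abs_le.1 h1).2
      nlinarith
    have := hv c b A hs hm
    refine this.trans (le_of_eq ?_)
    rw [ev_Lop]
    simp only [hA, mul_add, Finset.sum_add_distrib, mul_ite, mul_zero, Finset.sum_ite_eq,
      Finset.mem_univ, if_true]
    rw [Finset.mul_sum]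
    congr 2; ext; ring
  have hT := tr_pos hB
  refine le_of_forall_pos_le_add fun ε hε => ?_
  have := key (ε / ∑ i, B i i) (by positivity)
  rwa [div_mul_cancel₀ _ hT.ne'] at this

theorem quad_line {n : ℕ} (c : ℝ) (b : En n) (A : Matrix (Fin n) (Fin n) ℝ) (hA : A.IsSymm)
    (x₀ y : En n) (t : ℝ) : quadPoly c b A (x₀ + t • y) = quadPoly c b A x₀ +
      t * (∑ i, b i * y i + ∑ i, ∑ j, A i j * x₀ i * y j) +
      t ^ 2 * (1/2 * ∑ i, ∑ j, A i j * y i * y j) := by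
  simp only [quadPoly, PiLp.add_apply, PiLp.smul_apply, smul_eq_mul]
  have e : ∑ i, ∑ j, A i j * (x₀ i + t * y i) * (x₀ j + t * y j) =
     ∑ i, ∑ j, A i j * x₀ i * x₀ j + t * (2 * ∑ i, ∑ j, A i j * x₀ i * y j)
      + t ^ 2 * ∑ i, ∑ j, A i j * y i * y j := by
    have : ∑ i, ∑ j, A i j * y i * x₀ j = ∑ i, ∑ j, A i j * x₀ i * y j := by
      rw [Finset.sum_comm]
      refine Finset.sum_congr rfl fun i _ => Finset.sum_congr rfl fun j _ => ?_
      rw [hA.apply]; ring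
    rw [two_mul]
    nth_rewrite 1 [← this]
    simp only [Finset.mul_sum, mul_add, ← Finset.sum_add_distrib]
    refine Finset.sum_congr rfl fun i _ => Finset.sum_congr rfl fun j _ => ?_
    ring
  rw [e]
  have e2 : ∑ i, b i * (x₀ i + t * y i) = ∑ i, b i * x₀ i + t * ∑ i, b i * y i := by
    simp only [Finset.mul_sum, ← Finset.sum_add_distrib]
    refine Finset.sum_congr rfl fun i _ => ?_
    ring
  rw [e2]
  ring


theorem psd_of_localmin {n : ℕ} (c : ℝ) (b : En n) (A : Matrix (Fin n) (Fin n) ℝ) (hA : A.IsSymm)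
    (x₀ : En n) (h : ∀ y : En n, ∃ s > (0:ℝ), ∀ t, 0 < t → t < s →
      quadPoly c b A x₀ ≤ quadPoly c b A (x₀ + t • y) ∨
      quadPoly c b A x₀ ≤ quadPoly c b A (x₀ - t • y)) 
    (h0 : ∀ y : En n, ∑ i, b i * y i + ∑ i, ∑ j, A i j * x₀ i * y j = 0) : A.PosSemidef := by
  have hh : A.IsHermitian := by
    rw [Matrix.IsHermitian, Matrix.conjTranspose_eq_transpose_of_trivial]; exact hA
  refine Matrix.PosSemidef.of_dotProduct_mulVec_nonneg hh fun y => ?_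
  have hex : ∀ t : ℝ, quadPoly c b A (x₀ + t • (WithLp.toLp 2 y)) - quadPoly c b A x₀ =
      t ^ 2 / 2 * ∑ i, ∑ j, A i j * y i * y j := by
    intro t
    rw [quad_line c b A hA, h0]
    simp only []
    ring
  have hq : star y ⬝ᵥ A.mulVec y = ∑ i, ∑ j, A i j * y i * y j := by
    simp only [dotProduct, Matrix.mulVec, Finset.mul_sum, Pi.star_apply, star_trivial]
    refine Finset.sum_congr rfl fun i _ => Finset.sum_congr rfl fun j _ => ?_
    ring
  rw [hq]
  obtain ⟨s, hs, hs'⟩ := h (WithLp.toLp 2 y)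
  have hpos : 0 < (s/2)^2/2 := by positivity
  rcases hs' (s/2) (by positivity) (by linarith) with h1 | h1
  · have := hex (s/2)
    by_contra hneg
    push Not at hneg
    nlinarith
  · have := hex (-(s/2))
    rw [neg_smul, ← sub_eq_add_neg, neg_sq] at this
    by_contra hneg
    push Not at hneg
    nlinarith

theorem subAt_zero {n : ℕ} [NeZero n] {B : Fin n → Fin n → ℝ} {lam : ℝ} (hB : EllB n B lam)
    (x₀ : En n) (v : En n → ℝ) (hv : ∀ x, 0 ≤ v x) (hv0 : v x₀ = 0) : SubAt B v 0 x₀ := by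
  intro c b A hA hmax
  apply hB.mono
  have hmin : ∀ᶠ x in nhds x₀, quadPoly c b A x₀ ≤ quadPoly c b A x := by
    filter_upwards [hmax] with x hx
    have := hv x
    simp only [hv0] at hx
    linarith
  have hline : ∀ y : En n, ∀ᶠ t in nhds (0:ℝ), quadPoly c b A x₀ ≤ quadPoly c b A (x₀ + t • y) := by
    intro y
    have hc : Continuous fun t : ℝ => x₀ + t • y := by fun_prop
    have := hc.tendsto 0
    simp only [zero_smul, add_zero] at this
    exact this.eventually hmin
  apply psd_of_localmin c b A hA x₀
  · intro y
    obtain ⟨s, hs, h⟩ := Metric.eventually_nhds_iff.1 (hline y)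
    refine ⟨s, hs, fun t ht hts => Or.inl (h ?_)⟩
    simpa [abs_of_pos ht] using hts
  · intro y
    set f : ℝ → ℝ := fun t => quadPoly c b A (x₀ + t • y) with hf
    have hmin0 : IsLocalMin f 0 := by
      filter_upwards [hline y] with t ht
      simpa [hf] using ht
    set g := ∑ i, b i * y i + ∑ i, ∑ j, A i j * x₀ i * y j with hg
    have hfe : f = fun t => quadPoly c b A x₀ + t * g + t ^ 2 * (1/2 * ∑ i, ∑ j, A i j * y i * y j) := by
      funext t
      exact quad_line c b A hA x₀ y t
    have hd : HasDerivAt f g 0 := by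
      rw [hfe]
      have h1 : HasDerivAt (fun t : ℝ => t * g) (1 * g) 0 := (hasDerivAt_id (0:ℝ)).mul_const g
      have h2 := ((hasDerivAt_pow 2 (0:ℝ)).mul_const (1/2 * ∑ i, ∑ j, A i j * y i * y j))
      have := (h1.const_add (quadPoly c b A x₀)).add h2
      refine this.congr_deriv ?_
      simp
    exact hmin0.hasDerivAt_eq_zero hd

def sqd {n : ℕ} (x₀ : En n) : MPol n := ∑ i, (MvPolynomial.X i - MvPolynomial.C (x₀ i)) ^ 2

theorem ev_sqd {n : ℕ} (x₀ x : En n) : ev (sqd x₀) x = ‖x - x₀‖ ^ 2 := by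
  rw [nsq]; simp [sqd, map_sum]

theorem pd_sqd {n : ℕ} (x₀ : En n) (i : Fin n) : MvPolynomial.pderiv i (sqd x₀) =
    2 * (MvPolynomial.X i - MvPolynomial.C (x₀ i)) := by
  simp only [sqd, map_sum]
  rw [Finset.sum_eq_single i]
  · rw [MvPolynomial.pderiv_pow]; simp
  · intro j _ hj
    rw [MvPolynomial.pderiv_pow]; simp [MvPolynomial.pderiv_X_of_ne hj]
  · simp

theorem ev_pd_sqd {n : ℕ} (x₀ x : En n) (i : Fin n) : ev (MvPolynomial.pderiv i (sqd x₀)) x =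
    2 * (x i - x₀ i) := by
  rw [pd_sqd]; simp

theorem ev_pd2_sqd {n : ℕ} (x₀ x : En n) (i j : Fin n) :
    ev (MvPolynomial.pderiv i (MvPolynomial.pderiv j (sqd x₀))) x = if i = j then 2 else 0 := by
  rw [pd_sqd]
  have : (2 : MPol n) = MvPolynomial.C 2 := (map_ofNat MvPolynomial.C 2).symm
  rw [this, MvPolynomial.pderiv_C_mul]
  by_cases h : i = j
  · subst h; simp
  · simp [MvPolynomial.pderiv_X_of_ne (Ne.symm h), h]

theorem ev_Lop_sqd {n : ℕ} (B : Fin n → Fin n → ℝ) (x₀ x : En n) :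
    ev (Lop B (sqd x₀)) x = 2 * ∑ i, B i i := by
  rw [ev_Lop]
  simp only [ev_pd2_sqd, mul_ite, mul_zero, Finset.sum_ite_eq, Finset.mem_univ, if_true]
  rw [Finset.mul_sum]; congr 1; ext; ring

theorem ev_cont {n : ℕ} (p : MPol n) : Continuous (ev p) := by
  have := MvPolynomial.continuous_eval p
  exact this.comp (PiLp.continuous_ofLp 2 _)

theorem vcmp {n : ℕ} [NeZero n] {B : Fin n → Fin n → ℝ} {lam : ℝ} (hB : EllB n B lam)
    {v : En n → ℝ} {κ : ℝ} {x₀ : En n} {r : ℝ} 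
    (hc : Continuous v) (hv : ∀ y ∈ ball x₀ r, SubAt B v κ y) (p : MPol n)
    (hp : ∀ y ∈ ball x₀ r, ev (Lop B p) y ≤ κ) (ε : ℝ)
    (hb : ∀ y ∈ sphere x₀ r, v y ≤ ev p y + ε) :
    ∀ y ∈ closedBall x₀ r, v y ≤ ev p y + ε := by
  intro y hy
  by_contra hneg
  push Not at hneg
  have hr : 0 ≤ r := dist_nonneg.trans hy
  set d := v y - ev p y - ε with hd
  have hd0 : 0 < d := by rw [hd]; linarith
  set δ := d / (2 * (r ^ 2 + 1)) with hδ
  have hδ0 : 0 < δ := by positivity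
  have hδr : δ * r ^ 2 < d := by
    rw [hδ, div_mul_eq_mul_div, div_lt_iff₀ (by positivity)]
    nlinarith [sq_nonneg r]
  set p' : MPol n := p - δ • sqd x₀ with hp'
  have hev : ∀ x, ev p' x = ev p x - δ * ‖x - x₀‖ ^ 2 := by
    intro x; rw [← ev_sqd]; simp [hp', ev, MvPolynomial.smul_eval]
  have hL : ∀ x, ev (Lop B p') x = ev (Lop B p) x - δ * (2 * ∑ i, B i i) := by
    intro x; rw [← ev_Lop_sqd B x₀ x]; simp [hp', ev, MvPolynomial.smul_eval]
  have hcc : ContinuousOn (fun x => v x - ev p' x) (closedBall x₀ r) :=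
    (hc.sub (ev_cont p')).continuousOn
  obtain ⟨z, hz, hzm⟩ := (isCompact_closedBall x₀ r).exists_isMaxOn ⟨y, hy⟩ hcc
  have h1 := hzm hy
  simp only [Set.mem_setOf_eq, hev] at h1
  have h2 : 0 ≤ δ * ‖y - x₀‖ ^ 2 := by positivity
  have hzb : z ∈ ball x₀ r := by
    by_contra hzb
    have hzs : z ∈ sphere x₀ r := by
      rw [mem_sphere]; rw [mem_ball] at hzb; exact le_antisymm hz (not_lt.1 hzb)
    have := hb z hzs
    rw [mem_sphere, dist_eq_norm] at hzs
    rw [hzs] at h1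
    linarith
  have hlm : IsLocalMax (fun x => v x - ev p' x) z := by
    filter_upwards [isOpen_ball.mem_nhds hzb] with x hx
    exact hzm (ball_subset_closedBall hx)
  have h3 := touch hB (hv z hzb) p' hlm
  rw [hL] at h3
  have := hp z hzb
  have : 0 < δ * (2 * ∑ i, B i i) := by have := tr_pos hB; positivity
  linarith

theorem subAt_const {n : ℕ} [NeZero n] {B : Fin n → Fin n → ℝ} {lam : ℝ} (hB : EllB n B lam)
    (x₀ : En n) : SubAt B (fun _ => 0) 0 x₀ := subAt_zero hB x₀ _ (fun _ => le_rfl) rfl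

theorem maxp {n : ℕ} [NeZero n] {B : Fin n → Fin n → ℝ} {lam : ℝ} (hB : EllB n B lam)
    {x₀ : En n} {r : ℝ} (p : MPol n)
    (hp : ∀ y ∈ ball x₀ r, 0 ≤ ev (Lop B p) y) (m : ℝ)
    (hb : ∀ y ∈ sphere x₀ r, ev p y ≤ m) :
    ∀ y ∈ closedBall x₀ r, ev p y ≤ m := by
  intro y hy
  have := vcmp hB (v := fun _ => 0) (κ := 0) continuous_const (fun z _ => subAt_const hB z) (-p)
    (fun z hz => by have := hp z hz; simp [ev] at this ⊢; exact this) m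
    (fun z hz => by have := hb z hz; simp [ev] at this ⊢; exact this) y hy
  simp [ev] at this ⊢; exact this

open MvPolynomial in
theorem deg_pd {n : ℕ} (i : Fin n) (p : MPol n) (N : ℕ) (h : p.totalDegree ≤ N + 1) :
    (pderiv i p).totalDegree ≤ N := by
  refine Finset.sup_le fun m hm => ?_
  rw [mem_support_iff, coeff_pderiv] at hm
  have h1 : coeff (m + Finsupp.single i 1) p ≠ 0 := fun h0 => hm (by simp [h0])
  have h2 := le_totalDegree (mem_support_iff.2 h1)
  rw [Finsupp.sum_add_index' (by simp) (by simp)] at h2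
  simp at h2
  exact Nat.le_of_lt_succ (lt_of_lt_of_le h2 h)

open MvPolynomial in
theorem deg_Lop {n : ℕ} (B : Fin n → Fin n → ℝ) (p : MPol n) (N : ℕ) (h : p.totalDegree ≤ N + 2) :
    (Lop B p).totalDegree ≤ N := by
  rw [← mem_restrictTotalDegree]
  simp only [Lop, LinearMap.sum_apply]
  refine Submodule.sum_mem _ fun i _ => Submodule.sum_mem _ fun j _ => ?_
  refine Submodule.smul_mem _ _ ?_
  rw [mem_restrictTotalDegree]
  exact deg_pd i _ _ (deg_pd j _ _ h)

def psi {n : ℕ} (x₀ : En n) (r : ℝ) : MPol n := MvPolynomial.C (r ^ 2) - sqd x₀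

theorem ev_psi {n : ℕ} (x₀ x : En n) (r : ℝ) : ev (psi x₀ r) x = r ^ 2 - ‖x - x₀‖ ^ 2 := by
  rw [← ev_sqd]; simp [psi, ev]

open MvPolynomial in
theorem deg_psi {n : ℕ} (x₀ : En n) (r : ℝ) : (psi x₀ r).totalDegree ≤ 2 := by
  rw [← mem_restrictTotalDegree]
  refine Submodule.sub_mem _ ?_ (Submodule.sum_mem _ fun i _ => ?_)
  · rw [mem_restrictTotalDegree, totalDegree_C]; omega
  · rw [mem_restrictTotalDegree]
    refine (totalDegree_pow _ _).trans ?_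
    have : (X i - C (x₀ i) : MPol n).totalDegree ≤ 1 := by
      refine (totalDegree_sub _ _).trans ?_
      simp
    omega

open MvPolynomial in
theorem eq_zero_of_ball {n : ℕ} (p : MPol n) (x₀ : En n) {r : ℝ} (hr : 0 < r)
    (h : ∀ y ∈ ball x₀ r, ev p y = 0) : p = 0 := by
  have hU : (WithLp.toLp 2) ⁻¹' (ball x₀ r) ∈ nhds (x₀.ofLp) := by
    refine (PiLp.continuous_toLp 2 _).continuousAt.preimage_mem_nhds ?_
    exact isOpen_ball.mem_nhds (mem_ball_self hr)
  obtain ⟨s, hs, hsub⟩ := Metric.mem_nhds_iff.1 hU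
  refine funext_set (fun i => ball (x₀ i) s) (fun i => ?_) fun x hx => ?_
  · exact infinite_of_mem_nhds (x₀ i) (isOpen_ball.mem_nhds (mem_ball_self hs))
  · have hx' : x ∈ ball (x₀.ofLp) s := by
      rw [ball_pi _ hs]; exact hx
    have := h _ (hsub hx')
    simpa [ev] using this

open MvPolynomial in
theorem dirichlet_poly {n : ℕ} [NeZero n] {B : Fin n → Fin n → ℝ} {lam : ℝ} (hB : EllB n B lam)
    (x₀ : En n) {r : ℝ} (hr : 0 < r) (p : MPol n) (κ : ℝ) :
    ∃ h : MPol n, (∀ x, ev (Lop B h) x = κ) ∧ ∀ y ∈ sphere x₀ r, ev h y = ev p y := by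
  set N := p.totalDegree with hN
  let V := restrictTotalDegree (Fin n) ℝ N
  let Φ0 : MPol n →ₗ[ℝ] MPol n := Lop B ∘ₗ (LinearMap.mulLeft ℝ (psi x₀ r))
  have hmap : ∀ q ∈ V, Φ0 q ∈ V := by
    intro q hq
    rw [mem_restrictTotalDegree] at hq ⊢
    refine deg_Lop B _ _ ?_
    refine (totalDegree_mul _ _).trans ?_
    have := deg_psi x₀ r
    omega
  let Φ : V →ₗ[ℝ] V := Φ0.restrict hmap
  have hinj : Function.Injective Φ := by
    rw [← LinearMap.ker_eq_bot, LinearMap.ker_eq_bot']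
    intro q hq
    have hq' : Lop B (psi x₀ r * q.1) = 0 := by
      have := congrArg Subtype.val hq
      simpa [Φ, Φ0] using this
    have hs : ∀ y ∈ sphere x₀ r, ev (psi x₀ r * q.1) y = 0 := by
      intro y hy
      rw [mem_sphere, dist_eq_norm] at hy
      have := ev_psi x₀ y r
      simp only [ev, map_mul] at this ⊢
      rw [this, hy]; simp
    have h1 := maxp hB (x₀ := x₀) (r := r) (psi x₀ r * q.1) (fun y _ => by rw [hq']; simp [ev]) 0
      (fun y hy => (hs y hy).le)
    have h2 := maxp hB (x₀ := x₀) (r := r) (-(psi x₀ r * q.1))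
      (fun y _ => by rw [map_neg, hq']; simp [ev]) 0
      (fun y hy => by have := hs y hy; simp only [ev, map_neg] at this ⊢; linarith)
    have h3 : psi x₀ r * q.1 = 0 := by
      refine eq_zero_of_ball _ x₀ hr fun y hy => ?_
      have a := h1 y (ball_subset_closedBall hy)
      have b := h2 y (ball_subset_closedBall hy)
      simp only [ev, map_neg] at a b ⊢
      linarith
    rcases mul_eq_zero.1 h3 with h4 | h4
    · have := ev_psi x₀ x₀ r
      rw [h4] at this
      simp [ev] at this
      exact absurd this.symm (by positivity)
    · exact Subtype.ext h4
  have hsurj := LinearMap.injective_iff_surjective.1 hinj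
  have hmem : Lop B p - C κ ∈ V := by
    refine Submodule.sub_mem _ ?_ ?_
    · rw [mem_restrictTotalDegree]; exact deg_Lop B p N (by omega)
    · rw [mem_restrictTotalDegree]; simp
  obtain ⟨q, hq⟩ := hsurj ⟨_, hmem⟩
  have hq' : Lop B (psi x₀ r * q.1) = Lop B p - C κ := by
    have := congrArg Subtype.val hq
    simpa [Φ, Φ0] using this
  refine ⟨p - psi x₀ r * q.1, fun x => ?_, fun y hy => ?_⟩
  · rw [map_sub, hq']; simp [ev]
  · rw [mem_sphere, dist_eq_norm] at hy
    have := ev_psi x₀ y r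
    simp only [ev, map_mul, map_sub] at this ⊢
    rw [this, hy]; simp

open MvPolynomial in
theorem approx_poly {n : ℕ} (g : En n → ℝ) (hg : Continuous g) (K : Set (En n)) (hK : IsCompact K)
    {ε : ℝ} (hε : 0 < ε) : ∃ p : MPol n, ∀ y ∈ K, |ev p y - g y| ≤ ε := by
  let co : Fin n → C(En n, ℝ) := fun i => ⟨fun x => x i, by fun_prop⟩
  let Φ : MPol n →ₐ[ℝ] C(En n, ℝ) := aeval co
  have hΦ : ∀ p x, Φ p x = ev p x := by
    intro p x
    induction p using MvPolynomial.induction_on with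
    | C a => simp [Φ, ev]
    | add p q hp hq => simp [ev] at hp hq ⊢; rw [hp, hq]
    | mul_X p k hp => simp [ev] at hp ⊢; rw [hp]; simp [Φ, co]
  have hsep : Φ.range.SeparatesPoints := by
    intro x y hxy
    have : ∃ i, x i ≠ y i := by
      by_contra h; push Not at h; exact hxy (by ext i; exact h i)
    obtain ⟨i, hi⟩ := this
    refine ⟨_, ⟨Φ (X i), ⟨X i, rfl⟩, rfl⟩, ?_⟩
    simpa [hΦ, ev] using hi
  obtain ⟨f, ⟨p, hp⟩, hf⟩ :=
    ContinuousMap.exists_mem_subalgebra_near_continuous_of_isCompact_of_separatesPoints hsep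
      ⟨g, hg⟩ hK hε
  refine ⟨p, fun y hy => ?_⟩
  have := hf y hy
  rw [← hp] at this
  have h2 := hΦ p y
  simp only [Real.norm_eq_abs, ContinuousMap.coe_mk] at this
  rw [← h2]
  exact this.le

theorem dirichlet {n : ℕ} [NeZero n] {B : Fin n → Fin n → ℝ} {lam : ℝ} (hB : EllB n B lam)
    (g : En n → ℝ) (hg : Continuous g)
    (x₀ : En n) {r : ℝ} (hr : 0 < r) (κ : ℝ) {ε : ℝ} (hε : 0 < ε) :
    ∃ h : MPol n, (∀ x, ev (Lop B h) x = κ) ∧ ∀ y ∈ sphere x₀ r, |ev h y - g y| ≤ ε := by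
  obtain ⟨p, hp⟩ := approx_poly g hg (sphere x₀ r) (isCompact_sphere x₀ r) hε
  obtain ⟨h, h1, h2⟩ := dirichlet_poly hB x₀ hr p κ
  exact ⟨h, h1, fun y hy => by rw [h2 y hy]; exact hp y hy⟩

def Gam {n : ℕ} (B : Fin n → Fin n → ℝ) (p q : MPol n) (x : En n) : ℝ :=
  ∑ i, ∑ j, B i j * (ev (MvPolynomial.pderiv i p) x * ev (MvPolynomial.pderiv j q) x)

theorem ev_mul' {n : ℕ} (p q : MPol n) (x : En n) : ev (p * q) x = ev p x * ev q x := by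
  simp [ev]

theorem ev_pd_mul {n : ℕ} (p q : MPol n) (i : Fin n) (x : En n) :
    ev (MvPolynomial.pderiv i (p * q)) x = ev (MvPolynomial.pderiv i p) x * ev q x
      + ev p x * ev (MvPolynomial.pderiv i q) x := by
  rw [MvPolynomial.pderiv_mul]; simp [ev]

theorem ev_Lop_mul {n : ℕ} {B : Fin n → Fin n → ℝ} (hs : ∀ i j, B i j = B j i)
    (p q : MPol n) (x : En n) : ev (Lop B (p * q)) x =
      ev p x * ev (Lop B q) x + ev q x * ev (Lop B p) x + 2 * Gam B p q x := by
  have hG : Gam B p q x = ∑ i, ∑ j, B i j *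
      (ev (MvPolynomial.pderiv j p) x * ev (MvPolynomial.pderiv i q) x) := by
    rw [Gam, Finset.sum_comm]
    refine Finset.sum_congr rfl fun i _ => Finset.sum_congr rfl fun j _ => ?_
    rw [hs]
  rw [two_mul]
  nth_rewrite 1 [hG]
  rw [Gam]
  simp only [ev_Lop, Finset.mul_sum, ← Finset.sum_add_distrib]
  refine Finset.sum_congr rfl fun i _ => Finset.sum_congr rfl fun j _ => ?_
  rw [MvPolynomial.pderiv_mul]
  simp only [ev, map_add, map_mul, MvPolynomial.pderiv_mul]
  ring

theorem Gam_sq {n : ℕ} (B : Fin n → Fin n → ℝ) (p q : MPol n) (x : En n) :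
    Gam B (p * p) (q * q) x = 4 * (ev p x * ev q x) * Gam B p q x := by
  simp only [Gam, Finset.mul_sum, ev_pd_mul]
  refine Finset.sum_congr rfl fun i _ => Finset.sum_congr rfl fun j _ => ?_
  ring

theorem Gam_lower {n : ℕ} {B : Fin n → Fin n → ℝ} {lam : ℝ} (hB : EllB n B lam) (p : MPol n)
    (x : En n) : lam * ∑ i, ev (MvPolynomial.pderiv i p) x ^ 2 ≤ Gam B p p x :=
  hB.coer fun i => ev (MvPolynomial.pderiv i p) x

theorem Gam_cs {n : ℕ} {B : Fin n → Fin n → ℝ} {lam : ℝ} (hB : EllB n B lam) (p q : MPol n)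
    (x : En n) (a b : ℝ) :
    0 ≤ a ^ 2 * Gam B p p x + 2 * (a * b) * Gam B p q x + b ^ 2 * Gam B q q x := by
  have h := hB.coer fun i => a * ev (MvPolynomial.pderiv i p) x + b * ev (MvPolynomial.pderiv i q) x
  have h0 : 0 ≤ lam * ∑ i, (a * ev (MvPolynomial.pderiv i p) x +
      b * ev (MvPolynomial.pderiv i q) x) ^ 2 :=
    mul_nonneg hB.pos.le (Finset.sum_nonneg fun i _ => sq_nonneg _)
  refine (h0.trans h).trans (le_of_eq ?_)
  have hG : Gam B p q x = ∑ i, ∑ j, B i j *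
      (ev (MvPolynomial.pderiv j p) x * ev (MvPolynomial.pderiv i q) x) := by
    rw [Gam, Finset.sum_comm]
    refine Finset.sum_congr rfl fun i _ => Finset.sum_congr rfl fun j _ => ?_
    rw [hB.symm]
  have : 2 * (a * b) * Gam B p q x = (a * b) * Gam B p q x + (a * b) * Gam B p q x := by ring
  rw [this]
  nth_rewrite 1 [hG]
  simp only [Gam, Finset.mul_sum, ← Finset.sum_add_distrib]
  refine Finset.sum_congr rfl fun i _ => Finset.sum_congr rfl fun j _ => ?_
  ring

def dd {n : ℕ} (e : En n) (p : MPol n) : MPol n := ∑ i, e i • MvPolynomial.pderiv i p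

theorem Lop_dd {n : ℕ} (B : Fin n → Fin n → ℝ) (e : En n) (p : MPol n) :
    Lop B (dd e p) = dd e (Lop B p) := by
  have hL : ∀ q : MPol n, Lop B q = ∑ i, ∑ j, B i j •
      MvPolynomial.pderiv i (MvPolynomial.pderiv j q) := by
    intro q; simp [Lop, LinearMap.sum_apply]
  have h3 : ∀ i j, MvPolynomial.pderiv i (MvPolynomial.pderiv j (∑ k, e k • MvPolynomial.pderiv k p))
     = ∑ k, e k • MvPolynomial.pderiv k (MvPolynomial.pderiv i (MvPolynomial.pderiv j p)) := by
    intro i j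
    simp only [map_sum, Derivation.map_smul]
    refine Finset.sum_congr rfl fun k _ => ?_
    rw [pd_comm j k, pd_comm i k]
  simp only [dd]
  rw [hL, hL]
  simp only [h3, map_sum, Derivation.map_smul, Finset.smul_sum]
  conv_rhs => rw [Finset.sum_comm]
  refine Finset.sum_congr rfl fun i _ => ?_
  conv_rhs => rw [Finset.sum_comm]
  refine Finset.sum_congr rfl fun j _ => Finset.sum_congr rfl fun k _ => ?_
  rw [smul_comm, pd_comm j k, pd_comm i k]

theorem ev_dd {n : ℕ} (e : En n) (p : MPol n) (x : En n) :
    ev (dd e p) x = ∑ i, e i * ev (MvPolynomial.pderiv i p) x := by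
  simp [ev, dd, map_sum, MvPolynomial.smul_eval]

theorem dd_sq {n : ℕ} (e : En n) (p : MPol n) (x : En n) :
    ev (dd e p) x ^ 2 ≤ ‖e‖ ^ 2 * ∑ i, ev (MvPolynomial.pderiv i p) x ^ 2 := by
  rw [ev_dd, nsq]
  exact Finset.sum_mul_sq_le_sq_mul_sq _ _ _

theorem bern {n : ℕ} [NeZero n] {B : Fin n → Fin n → ℝ} {lam : ℝ} (hB : EllB n B lam) :
    ∃ c₀ : ℝ, 0 < c₀ ∧ ∀ (P : MPol n) (_ : Lop B P = 0) (e x₀ : En n) (r m : ℝ) (_ : 0 < r)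
      (_ : ∀ y ∈ closedBall x₀ r, |ev P y| ≤ m), (ev (dd e P) x₀ * r) ^ 2 ≤ c₀ * (‖e‖ * m) ^ 2 := by
  set T := ∑ i, B i i with hT
  have hT0 : 0 < T := tr_pos hB
  set Λ := ∑ i, ∑ j, |B i j| with hΛ
  have hΛ0 : 0 ≤ Λ := Finset.sum_nonneg fun i _ => Finset.sum_nonneg fun j _ => abs_nonneg _
  have hup : ∀ v : En n, ∑ i, ∑ j, B i j * (v i * v j) ≤ Λ * ‖v‖ ^ 2 := by
    intro v
    rw [hΛ, Finset.sum_mul]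
    refine Finset.sum_le_sum fun i _ => ?_
    rw [Finset.sum_mul]
    refine Finset.sum_le_sum fun j _ => ?_
    have h1 := PiLp.norm_apply_le v i
    have h2 := PiLp.norm_apply_le v j
    rw [Real.norm_eq_abs] at h1 h2
    calc B i j * (v i * v j) ≤ |B i j * (v i * v j)| := le_abs_self _
      _ = |B i j| * (|v i| * |v j|) := by rw [abs_mul, abs_mul]
      _ ≤ |B i j| * ‖v‖ ^ 2 := by rw [pow_two]; gcongr
  have hlam := hB.pos
  refine ⟨(2 * T + 12 * Λ) / lam, by positivity, fun P hP e x₀ r m hr hm => ?_⟩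
  set ζ := psi x₀ r with hζ
  set D := dd e P with hD
  have hLD : Lop B D = 0 := by rw [hD, Lop_dd, hP]; simp [dd]
  set k := ‖e‖ ^ 2 * r ^ 2 * ((2 * T + 12 * Λ) / lam) with hk
  have hk0 : 0 ≤ k := by positivity
  set Q : MPol n := (ζ * ζ) * (D * D) + k • (P * P) with hQ
  have hevQ : ∀ y, ev Q y = ev ζ y ^ 2 * ev D y ^ 2 + k * ev P y ^ 2 := by
    intro y; simp [hQ, ev, MvPolynomial.smul_eval]; ring
  have hLζ : ∀ y, ev (Lop B ζ) y = - (2 * T) := by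
    intro y
    rw [hT, ← ev_Lop_sqd B x₀ y, hζ, psi, map_sub]
    have : Lop B (MvPolynomial.C (r ^ 2)) = 0 := by
      simp [Lop, LinearMap.sum_apply]
    rw [this]; simp [ev]
  have hpdζ : ∀ i y, ev (MvPolynomial.pderiv i ζ) y = - (2 * (y i - x₀ i)) := by
    intro i y
    rw [← ev_pd_sqd, hζ, psi, map_sub, MvPolynomial.pderiv_C]; simp [ev]
  have hΓζ : ∀ y, Gam B ζ ζ y ≤ 4 * Λ * ‖y - x₀‖ ^ 2 := by
    intro y
    have := hup (y - x₀)
    have e : Gam B ζ ζ y = 4 * ∑ i, ∑ j, B i j * ((y - x₀) i * (y - x₀) j) := by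
      simp only [Gam, hpdζ, Finset.mul_sum, PiLp.sub_apply]
      refine Finset.sum_congr rfl fun i _ => Finset.sum_congr rfl fun j _ => ?_
      ring
    rw [e]; linarith
  have hLQ : ∀ y ∈ ball x₀ r, 0 ≤ ev (Lop B Q) y := by
    intro y hy
    rw [mem_ball, dist_eq_norm] at hy
    have hy2 : ‖y - x₀‖ ^ 2 ≤ r ^ 2 := by gcongr
    have e1 : ev (Lop B Q) y = ev (Lop B ((ζ * ζ) * (D * D))) y + k * ev (Lop B (P * P)) y := by
      simp [hQ, ev, MvPolynomial.smul_eval]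
    have hz : ev (0 : MPol n) y = 0 := by simp [ev]
    rw [e1, ev_Lop_mul hB.symm (ζ * ζ), ev_Lop_mul hB.symm D, ev_Lop_mul hB.symm ζ,
      ev_Lop_mul hB.symm P, Gam_sq, hLD, hP, hLζ, ev_mul', ev_mul', hz]
    have hcs := Gam_cs hB ζ D y (2 * ev D y) (ev ζ y)
    have hlow := Gam_lower hB P y
    have hds := dd_sq e P y
    rw [← hD] at hds
    have hζe := ev_psi x₀ y r
    rw [← hζ] at hζe
    have hζ0 : 0 ≤ ev ζ y := by rw [hζe]; linarith
    have hζ1 : ev ζ y ≤ r ^ 2 := by rw [hζe]; nlinarith [sq_nonneg ‖y - x₀‖]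
    have hg := hΓζ y
    have hg' : Gam B ζ ζ y ≤ 4 * Λ * r ^ 2 := hg.trans (by gcongr)
    have hkk : ev D y ^ 2 * (r ^ 2 * (2 * T + 12 * Λ)) ≤ k * Gam B P P y := by
      have : k * (lam * ∑ i, ev (MvPolynomial.pderiv i P) y ^ 2) =
          (‖e‖ ^ 2 * ∑ i, ev (MvPolynomial.pderiv i P) y ^ 2) * (r ^ 2 * (2 * T + 12 * Λ)) := by
        rw [hk]; field_simp
      calc _ ≤ (‖e‖ ^ 2 * ∑ i, ev (MvPolynomial.pderiv i P) y ^ 2) * (r ^ 2 * (2 * T + 12 * Λ)) := by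
              gcongr
        _ = _ := this.symm
        _ ≤ _ := by gcongr
    have h5 : ev D y ^ 2 * (ev ζ y * T) ≤ ev D y ^ 2 * (r ^ 2 * T) := by gcongr
    have h6 : ev D y ^ 2 * Gam B ζ ζ y ≤ ev D y ^ 2 * (4 * Λ * r ^ 2) := by gcongr
    nlinarith
  have hm0 : 0 ≤ m := (abs_nonneg _).trans (hm x₀ (mem_closedBall_self hr.le))
  have hsph : ∀ y ∈ sphere x₀ r, ev Q y ≤ k * m ^ 2 := by
    intro y hy
    have hPy := hm y (sphere_subset_closedBall hy)
    rw [mem_sphere, dist_eq_norm] at hy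
    rw [hevQ, hζ, ev_psi, hy]
    have : ev P y ^ 2 ≤ m ^ 2 := sq_le_sq.2 (by rwa [abs_of_nonneg hm0])
    simp only [sub_self]
    nlinarith
  have hfin := maxp hB Q hLQ _ hsph x₀ (mem_closedBall_self hr.le)
  rw [hevQ, hζ, ev_psi] at hfin
  simp only [sub_self, norm_zero] at hfin
  have h7 : 0 ≤ k * ev P x₀ ^ 2 := by positivity
  have h8 : r ^ 2 * (ev D x₀ * r) ^ 2 ≤ r ^ 2 * ((2 * T + 12 * Λ) / lam * (‖e‖ * m) ^ 2) := by
    have : r ^ 2 * ((2 * T + 12 * Λ) / lam * (‖e‖ * m) ^ 2) = k * m ^ 2 := by rw [hk]; ring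
    rw [this]; nlinarith
  exact le_of_mul_le_mul_left h8 (by positivity)

theorem ev_line {n : ℕ} (P : MPol n) (x e : En n) (t : ℝ) :
    HasDerivAt (fun t : ℝ => ev P (x + t • e)) (ev (dd e P) (x + t • e)) t := by
  rw [ev_dd]
  induction P using MvPolynomial.induction_on with
  | C a => simpa [ev] using hasDerivAt_const t a
  | add p q hp hq =>
    refine ((hp.add hq).congr_deriv ?_).congr_of_eventuallyEq ?_
    · simp [ev, mul_add, Finset.sum_add_distrib]
    · exact Eventually.of_forall fun s => by simp [ev]
  | mul_X p k hp =>
    have hx : HasDerivAt (fun t : ℝ => (x + t • e) k) (e k) t := by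
      have := ((hasDerivAt_id t).mul_const (e k)).const_add (x k)
      simpa using this
    refine ((hp.mul hx).congr_deriv ?_).congr_of_eventuallyEq ?_
    · simp only [ev_pd_mul, mul_add, Finset.sum_add_distrib, Finset.sum_mul]
      have e1 : ∀ i, ev (MvPolynomial.pderiv i (MvPolynomial.X k : MPol n)) (x + t • e) =
          if k = i then 1 else 0 := by
        intro i
        by_cases h : k = i
        · subst h; simp [ev]
        · simp [ev, MvPolynomial.pderiv_X_of_ne h, h]
      simp only [e1, mul_ite, mul_one, mul_zero, Finset.sum_ite_eq, Finset.mem_univ, if_true]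
      have e2 : ev (MvPolynomial.X k : MPol n) (x + t • e) = (x + t • e) k := by simp [ev]
      rw [e2]
      congr 1
      · refine Finset.sum_congr rfl fun i _ => ?_; ring
      · ring
    · exact Eventually.of_forall fun s => by simp [ev]

theorem second_diff {n : ℕ} [NeZero n] {B : Fin n → Fin n → ℝ} {lam : ℝ} (hB : EllB n B lam) :
    ∃ K : ℝ, 0 < K ∧ ∀ (P : MPol n) (_ : Lop B P = 0) (τ x₀ : En n) (r m : ℝ) (_ : 0 < r)
      (_ : ‖τ‖ ≤ r / 4)
      (_ : ∀ y ∈ closedBall x₀ r, |ev P y| ≤ m),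
      |2 * ev P x₀ - ev P (x₀ + τ) - ev P (x₀ - τ)| ≤ K * ‖τ‖ ^ 2 * (m / r ^ 2) := by
  obtain ⟨c₀, hc0, hc⟩ := bern hB
  refine ⟨16 * c₀, by positivity, fun P hP τ x₀ r m hr hτ hm => ?_⟩
  have hm0 : 0 ≤ m := (abs_nonneg _).trans (hm x₀ (mem_closedBall_self hr.le))
  have h1 : ∀ y ∈ closedBall x₀ (r / 2), |ev (dd τ P) y| ≤ √c₀ * (‖τ‖ * m) / (r / 2) := by
    intro y hy
    have := hc P hP τ y (r / 2) m (by positivity) (fun z hz => hm z (by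
      rw [mem_closedBall] at *
      have := dist_triangle z y x₀
      linarith))
    rw [le_div_iff₀ (by positivity)]
    have h0 : (ev (dd τ P) y * (r / 2)) ^ 2 ≤ (√c₀ * (‖τ‖ * m)) ^ 2 := by
      rw [mul_pow (√c₀), Real.sq_sqrt hc0.le]; exact this
    have h3 := sq_le_sq.1 h0
    rwa [abs_mul, abs_of_pos (show 0 < r / 2 by positivity),
      abs_of_nonneg (show 0 ≤ √c₀ * (‖τ‖ * m) by positivity)] at h3
  have hLD : Lop B (dd τ P) = 0 := by rw [Lop_dd, hP]; simp [dd]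
  set S := 8 * c₀ * ‖τ‖ ^ 2 * (m / r ^ 2) with hS
  have hS0 : 0 ≤ S := by positivity
  have h2 : ∀ y ∈ closedBall x₀ (r / 4), |ev (dd τ (dd τ P)) y| ≤ S := by
    intro y hy
    have := hc (dd τ P) hLD τ y (r / 4) _ (by positivity) (fun z hz => h1 z (by
      rw [mem_closedBall] at *
      have := dist_triangle z y x₀
      linarith))
    have h3 : c₀ * (‖τ‖ * (√c₀ * (‖τ‖ * m) / (r / 2))) ^ 2 = (S * (r / 4)) ^ 2 := by
      have : (‖τ‖ * (√c₀ * (‖τ‖ * m) / (r / 2))) ^ 2 = √c₀ ^ 2 * (‖τ‖ * (‖τ‖ * m) / (r / 2)) ^ 2 := by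
        ring
      rw [this, Real.sq_sqrt hc0.le, hS]
      field_simp
      ring
    rw [h3] at this
    have h4 := sq_le_sq.1 this
    rw [abs_mul, abs_mul, abs_of_pos (show 0 < r / 4 by positivity), abs_of_nonneg hS0] at h4
    exact le_of_mul_le_mul_right h4 (by positivity)
  have hmem : ∀ t ∈ Icc (-1:ℝ) 1, x₀ + t • τ ∈ closedBall x₀ (r / 4) := by
    intro t ht
    rw [mem_closedBall, dist_eq_norm, add_sub_cancel_left, norm_smul, Real.norm_eq_abs]
    have : |t| ≤ 1 := abs_le.2 ht
    calc |t| * ‖τ‖ ≤ 1 * ‖τ‖ := by gcongr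
      _ ≤ _ := by linarith
  have hd1 : ∀ s ∈ Icc (-1:ℝ) 1, ∀ t ∈ Icc (-1:ℝ) 1,
      |ev (dd τ P) (x₀ + t • τ) - ev (dd τ P) (x₀ + s • τ)| ≤ S * |t - s| := by
    intro s hs t ht
    exact (convex_Icc (-1:ℝ) 1).norm_image_sub_le_of_norm_hasDerivWithin_le
      (f := fun t : ℝ => ev (dd τ P) (x₀ + t • τ))
      (fun u hu => (ev_line (dd τ P) x₀ τ u).hasDerivWithinAt)
      (fun u hu => h2 _ (hmem u hu)) hs ht
  have hg : ∀ t : ℝ, HasDerivAt (fun t : ℝ => ev P (x₀ + t • τ) + ev P (x₀ + (-t) • τ))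
      (ev (dd τ P) (x₀ + t • τ) + ev (dd τ P) (x₀ + (-t) • τ) * (-1)) t := by
    intro t
    have a := ev_line P x₀ τ t
    have b := (ev_line P x₀ τ (-t)).comp t (hasDerivAt_neg t)
    exact a.add b
  have hfin := (convex_Icc (0:ℝ) 1).norm_image_sub_le_of_norm_hasDerivWithin_le
      (f := fun t : ℝ => ev P (x₀ + t • τ) + ev P (x₀ + (-t) • τ)) (C := 2 * S)
      (fun u hu => (hg u).hasDerivWithinAt)
      (fun u hu => by
        have := hd1 (-u) ⟨by linarith [hu.2], by linarith [hu.1]⟩ u ⟨by linarith [hu.1], hu.2⟩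
        rw [Real.norm_eq_abs, mul_neg_one, ← sub_eq_add_neg]
        refine this.trans ?_
        rw [sub_neg_eq_add, abs_of_nonneg (by linarith [hu.1])]
        nlinarith [hu.2])
      (left_mem_Icc.2 zero_le_one) (right_mem_Icc.2 zero_le_one)
  simp only [one_smul, zero_smul, neg_zero, add_zero, neg_smul, ← sub_eq_add_neg, sub_zero,
    norm_one, mul_one, Real.norm_eq_abs] at hfin
  rw [← abs_neg]
  have e : -(2 * ev P x₀ - ev P (x₀ + τ) - ev P (x₀ - τ)) =
    ev P (x₀ + τ) + ev P (x₀ - τ) - (ev P x₀ + ev P x₀) := by ring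
  rw [e]
  refine hfin.trans (le_of_eq ?_)
  rw [hS]; ring

structure Sol {n : ℕ} [NeZero n] (B : Fin n → Fin n → ℝ) (v : En n → ℝ) (M : ℝ)
    (Ω : Set (En n)) : Prop where
  cont : Continuous v
  nonneg : ∀ x, 0 ≤ v x
  zero : ∀ x : En n, x 0 ≤ 0 → v x = 0
  growth : ∀ x, v x ≤ M * (‖x‖ ^ 2 + 1)
  sub0 : ∀ x, SubAt B v 0 x
  sup1 : ∀ x, SubAt B (fun y => - v y) (-1) x
  op : IsOpen Ω
  pos : ∀ x, 0 < v x → x ∈ Ω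
  sub1 : ∀ x ∈ Ω, SubAt B v 1 x

theorem subAt_trans {n : ℕ} {B : Fin n → Fin n → ℝ} {v : En n → ℝ} {κ : ℝ} {x₀ τ : En n}
    (h : SubAt B v κ (x₀ + τ)) : SubAt B (fun x => v (x + τ)) κ x₀ := by
  intro c b A hA hm
  obtain ⟨c', b', hq⟩ := quad_repr τ c (fun i => b i) A hA
  refine h c' b' A hA ?_
  have hq' : ∀ x, quadPoly c' b' A x = quadPoly c b A (x - τ) := by
    intro x; rw [hq]; simp [quadPoly]
  have ht : Tendsto (fun y : En n => y - τ) (nhds (x₀ + τ)) (nhds x₀) := by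
    have : Continuous (fun y : En n => y - τ) := by fun_prop
    simpa using this.tendsto (x₀ + τ)
  filter_upwards [ht.eventually hm] with y hy
  rw [hq', hq']
  simpa using hy

theorem local_contra {n : ℕ} [NeZero n] {B : Fin n → Fin n → ℝ} {lam : ℝ} (hB : EllB n B lam)
    {v a b : En n → ℝ} (hv : Continuous v) (ha : Continuous a) (hb : Continuous b)
    {z : En n} {r : ℝ} (hr : 0 < r) (hv1 : ∀ y ∈ ball z r, SubAt B v 1 y)
    (ha1 : ∀ y ∈ ball z r, SubAt B (fun y => - a y) (-1) y)
    (hb1 : ∀ y ∈ ball z r, SubAt B (fun y => - b y) (-1) y)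
    (q : MPol n) {κ : ℝ} (hκ : 0 < κ) (hq : ∀ y, ev (Lop B q) y = - κ)
    (hmax : ∀ y ∈ closedBall z r, 2 * v y - a y - b y - ev q y ≤ 2 * v z - a z - b z - ev q z) :
    False := by
  have hT := tr_pos hB
  set T := ∑ i, B i i with hTd
  set s := κ / (2 * T) with hs
  have hs0 : 0 < s := by positivity
  have hε : 0 < s * r ^ 2 / 16 := by positivity
  set ε := s * r ^ 2 / 16 with hεd
  obtain ⟨P, hP, hPs⟩ := dirichlet hB v hv z hr 1 hε
  obtain ⟨Pa, hPa, hPas⟩ := dirichlet hB a ha z hr 1 hε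
  obtain ⟨Pb, hPb, hPbs⟩ := dirichlet hB b hb z hr 1 hε
  have hz : z ∈ closedBall z r := mem_closedBall_self hr.le
  have h1 := vcmp hB hv hv1 P (fun y _ => (hP y).le) ε
    (fun y hy => by have := (abs_le.1 (hPs y hy)).1; linarith) z hz
  have h2 := vcmp hB (v := fun y => - a y) ha.neg ha1 (-Pa) (fun y _ => by
      have := hPa y; simp only [map_neg, ev] at *; linarith) ε
    (fun y hy => by have := (abs_le.1 (hPas y hy)).2; simp only [map_neg, ev] at *; linarith) z hz
  have h3 := vcmp hB (v := fun y => - b y) hb.neg hb1 (-Pb) (fun y _ => by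
      have := hPb y; simp only [map_neg, ev] at *; linarith) ε
    (fun y hy => by have := (abs_le.1 (hPbs y hy)).2; simp only [map_neg, ev] at *; linarith) z hz
  set Z : MPol n := (2:ℝ) • P - Pa - Pb - q - s • sqd z with hZ
  have hevZ : ∀ y, ev Z y = 2 * ev P y - ev Pa y - ev Pb y - ev q y - s * ‖y - z‖ ^ 2 := by
    intro y; rw [← ev_sqd]; simp [hZ, ev, MvPolynomial.smul_eval]
  have hLZ : ∀ y, ev (Lop B Z) y = 0 := by
    intro y
    have e : ev (Lop B Z) y = 2 * ev (Lop B P) y - ev (Lop B Pa) y - ev (Lop B Pb) y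
        - ev (Lop B q) y - s * ev (Lop B (sqd z)) y := by
      simp [hZ, ev, MvPolynomial.smul_eval]
    rw [e, hP, hPa, hPb, hq, ev_Lop_sqd, hs]
    field_simp
    ring
  have h4 := maxp hB Z (fun y _ => (hLZ y).ge) (2 * v z - a z - b z - ev q z + 4 * ε - s * r ^ 2)
    (fun y hy => by
      have g1 := (abs_le.1 (hPs y hy)).2
      have g2 := (abs_le.1 (hPas y hy)).1
      have g3 := (abs_le.1 (hPbs y hy)).1
      have g4 := hmax y (sphere_subset_closedBall hy)
      rw [mem_sphere, dist_eq_norm] at hy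
      rw [hevZ, hy]; linarith) z hz
  rw [hevZ] at h4
  simp only [map_neg, ev, sub_self, norm_zero] at *
  have : 0 < s * r ^ 2 := by positivity
  nlinarith

theorem harm_approx {n : ℕ} [NeZero n] {B : Fin n → Fin n → ℝ} {lam : ℝ} (hB : EllB n B lam)
    {v : En n → ℝ} {M : ℝ} {Ω : Set (En n)} (hv : Sol B v M Ω) (x : En n) {r : ℝ} (hr : 0 < r) :
    ∃ P : MPol n, Lop B P = 0 ∧ ∀ y ∈ closedBall x r, v y ≤ ev P y + 1 ∧
      ev P y ≤ v y + 1 + 1 / (2 * ∑ i, B i i) * r ^ 2 := by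
  have hT := tr_pos hB
  set s := 1 / (2 * ∑ i, B i i) with hs
  have hs0 : 0 < s := by positivity
  obtain ⟨P, hP, hPs⟩ := dirichlet hB v hv.cont x hr 0 one_pos
  refine ⟨P, ?_, fun y hy => ⟨?_, ?_⟩⟩
  · apply MvPolynomial.funext
    intro y
    simpa using hP (WithLp.toLp 2 y)
  · exact vcmp hB hv.cont (fun y _ => hv.sub0 y) P (fun y _ => (hP y).le) 1
      (fun y hy => by have := (abs_le.1 (hPs y hy)).1; linarith) y hy
  · have hev : ∀ y, ev (-P - s • sqd x) y = - ev P y - s * ‖y - x‖ ^ 2 := by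
      intro y; rw [← ev_sqd]; simp [ev, MvPolynomial.smul_eval]
    have := vcmp hB (v := fun y => - v y) hv.cont.neg (fun y _ => hv.sup1 y) (-P - s • sqd x)
      (fun y _ => by
        have e : ev (Lop B (-P - s • sqd x)) y = - ev (Lop B P) y - s * ev (Lop B (sqd x)) y := by
          simp [ev, MvPolynomial.smul_eval]
        rw [e, hP, ev_Lop_sqd, hs]
        apply le_of_eq
        field_simp
        ring) (1 + s * r ^ 2)
      (fun y hy => by
        have := (abs_le.1 (hPs y hy)).2
        rw [mem_sphere, dist_eq_norm] at hy
        rw [hev, hy]; linarith) y hy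
    rw [hev] at this
    have : 0 ≤ s * ‖y - x‖ ^ 2 := by positivity
    linarith

theorem growthW {n : ℕ} [NeZero n] {B : Fin n → Fin n → ℝ} {lam : ℝ} (hB : EllB n B lam)
    {v : En n → ℝ} {M : ℝ} (hM : 0 < M) {Ω : Set (En n)} (hv : Sol B v M Ω) (τ : En n) :
    ∃ C > 0, ∀ ρ : ℝ, 1 ≤ ρ → 4 * ‖τ‖ ≤ ρ → ∀ x, ‖x‖ ≤ ρ ^ 3 →
      2 * v x - v (x + τ) - v (x - τ) ≤ C * ρ ^ 2 := by
  have hT := tr_pos hB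
  set s := 1 / (2 * ∑ i, B i i) with hs
  have hs0 : 0 < s := by positivity
  obtain ⟨K, hK, hKd⟩ := second_diff hB
  refine ⟨4 + 2 * s + K * ‖τ‖ ^ 2 * (2 * (2 + s) + (5 * M + 1 + s)), by positivity,
    fun ρ h1 hτ x hx => ?_⟩
  have h0 : 0 < ρ := by linarith
  have h12 : ρ ≤ ρ ^ 2 := by nlinarith
  have h23 : ρ ^ 2 ≤ ρ ^ 3 := by nlinarith
  have hρ1 : 1 ≤ ρ ^ 2 := by linarith
  have hρ4 : 1 ≤ ρ ^ 4 := by nlinarith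
  have hρ6 : 1 ≤ ρ ^ 6 := by nlinarith
  have hρ24 : ρ ^ 2 ≤ ρ ^ 4 := by nlinarith
  have hρ46 : ρ ^ 4 ≤ ρ ^ 6 := by nlinarith
  obtain ⟨P₁, hP₁, hb₁⟩ := harm_approx hB hv x h0
  obtain ⟨P₂, hP₂, hb₂⟩ := harm_approx hB hv x (show 0 < ρ ^ 2 by positivity)
  obtain ⟨P₃, hP₃, hb₃⟩ := harm_approx hB hv x (show 0 < ρ ^ 3 by positivity)
  rw [← hs] at hb₁ hb₂ hb₃
  have hs24 : s * ρ ^ 2 ≤ s * ρ ^ 4 := by gcongr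
  have hs46 : s * ρ ^ 4 ≤ s * ρ ^ 6 := by gcongr
  have d12 := hKd (P₁ - P₂) (by rw [map_sub, hP₁, hP₂, sub_zero]) τ x ρ (2 + s * ρ ^ 4) h0
    (by linarith) (fun y hy => by
      have a := hb₁ y hy
      have b := hb₂ y (closedBall_subset_closedBall h12 hy)
      have e : ev (P₁ - P₂) y = ev P₁ y - ev P₂ y := by simp [ev]
      have e2 : s * (ρ ^ 2) ^ 2 = s * ρ ^ 4 := by ring
      rw [e2] at b
      rw [e, abs_le]; constructor <;> linarith [a.1, a.2, b.1, b.2])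
  have d23 := hKd (P₂ - P₃) (by rw [map_sub, hP₂, hP₃, sub_zero]) τ x (ρ ^ 2) (2 + s * ρ ^ 6)
    (by positivity)
    (by linarith) (fun y hy => by
      have a := hb₂ y hy
      have b := hb₃ y (closedBall_subset_closedBall h23 hy)
      have e : ev (P₂ - P₃) y = ev P₂ y - ev P₃ y := by simp [ev]
      have e2 : s * (ρ ^ 2) ^ 2 = s * ρ ^ 4 := by ring
      have e3 : s * (ρ ^ 3) ^ 2 = s * ρ ^ 6 := by ring
      rw [e2] at a
      rw [e3] at b
      rw [e, abs_le]; constructor <;> linarith [a.1, a.2, b.1, b.2])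
  have d3 := hKd P₃ hP₃ τ x (ρ ^ 3) ((5 * M + 1 + s) * ρ ^ 6)
    (by positivity)
    (by linarith) (fun y hy => by
      have b := hb₃ y hy
      have e3 : s * (ρ ^ 3) ^ 2 = s * ρ ^ 6 := by ring
      rw [e3] at b
      have hg := hv.growth y
      have hn := hv.nonneg y
      have hy' : ‖y‖ ≤ 2 * ρ ^ 3 := by
        rw [mem_closedBall, dist_eq_norm] at hy
        have := norm_le_norm_sub_add y x
        linarith
      have hy2 : ‖y‖ ^ 2 ≤ 4 * ρ ^ 6 := by
        calc ‖y‖ ^ 2 ≤ (2 * ρ ^ 3) ^ 2 := by gcongr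
          _ = _ := by ring
      have hM' : M * (‖y‖ ^ 2 + 1) ≤ M * (5 * ρ ^ 6) := by gcongr; linarith
      have h7 : 0 ≤ s * ρ ^ 6 := by positivity
      have h8 : 0 ≤ M * ρ ^ 6 := by positivity
      rw [abs_le]; constructor <;> nlinarith [b.1, b.2])
  have k0 : 0 ≤ K * ‖τ‖ ^ 2 := by positivity
  have m12 : (2 + s * ρ ^ 4) / ρ ^ 2 ≤ (2 + s) * ρ ^ 2 := by
    rw [div_le_iff₀ (by positivity)]; nlinarith
  have m23 : (2 + s * ρ ^ 6) / (ρ ^ 2) ^ 2 ≤ (2 + s) * ρ ^ 2 := by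
    rw [div_le_iff₀ (by positivity)]; nlinarith
  have m3 : ((5 * M + 1 + s) * ρ ^ 6) / (ρ ^ 3) ^ 2 ≤ (5 * M + 1 + s) * ρ ^ 2 := by
    rw [div_le_iff₀ (by positivity)]
    have : (5 * M + 1 + s) * ρ ^ 6 ≤ (5 * M + 1 + s) * ρ ^ 6 * ρ ^ 2 :=
      le_mul_of_one_le_right (by positivity) hρ1
    nlinarith
  have n12 := mul_le_mul_of_nonneg_left m12 k0
  have n23 := mul_le_mul_of_nonneg_left m23 k0
  have n3 := mul_le_mul_of_nonneg_left m3 k0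
  have mem1 : x + τ ∈ closedBall x ρ := by
    rw [mem_closedBall, dist_eq_norm, add_sub_cancel_left]; linarith [norm_nonneg τ]
  have mem2 : x - τ ∈ closedBall x ρ := by
    rw [mem_closedBall, dist_eq_norm, sub_sub_cancel_left, norm_neg]; linarith [norm_nonneg τ]
  have b0 := hb₁ x (mem_closedBall_self h0.le)
  have b1 := hb₁ _ mem1
  have b2 := hb₁ _ mem2
  have a12 := (abs_le.1 d12).2
  have a23 := (abs_le.1 d23).2
  have a3 := (abs_le.1 d3).2
  simp only [ev, map_sub] at *
  have fin : (4 + 2 * s + K * ‖τ‖ ^ 2 * (2 * (2 + s) + (5 * M + 1 + s))) * ρ ^ 2 =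
    4 * ρ ^ 2 + 2 * (s * ρ ^ 2) + K * ‖τ‖ ^ 2 * ((2 + s) * ρ ^ 2) + K * ‖τ‖ ^ 2 * ((2 + s) * ρ ^ 2)
     + K * ‖τ‖ ^ 2 * ((5 * M + 1 + s) * ρ ^ 2) := by ring
  rw [fin]
  linarith [b0.1, b1.2, b2.2]

def barr {n : ℕ} [NeZero n] (B : Fin n → Fin n → ℝ) (ω R : ℝ) : MPol n :=
  (ω / R ^ 2) • sqd 0 + (ω * ((∑ i, B i i + 1) / B 0 0) / R) • MvPolynomial.X 0
    - (ω * ((∑ i, B i i + 1) / B 0 0) / R ^ 2) • (MvPolynomial.X 0 * MvPolynomial.X 0)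

theorem ev_barr {n : ℕ} [NeZero n] (B : Fin n → Fin n → ℝ) (ω R : ℝ) (x : En n) :
    ev (barr B ω R) x = ω / R ^ 2 * ‖x‖ ^ 2 + (ω * ((∑ i, B i i + 1) / B 0 0) / R) * x 0
      - (ω * ((∑ i, B i i + 1) / B 0 0) / R ^ 2) * (x 0 * x 0) := by
  have := ev_sqd 0 x
  rw [sub_zero] at this
  rw [← this]
  simp [barr, ev, MvPolynomial.smul_eval]

theorem Lop_X {n : ℕ} (B : Fin n → Fin n → ℝ) (k : Fin n) (x : En n) :
    ev (Lop B (MvPolynomial.X k)) x = 0 := by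
  rw [ev_Lop]
  refine Finset.sum_eq_zero fun i _ => Finset.sum_eq_zero fun j _ => ?_
  rw [MvPolynomial.pderiv_X]
  by_cases h : j = k
  · subst h; simp [ev]
  · simp [ev, Pi.single_apply, Ne.symm h, h]

theorem ev_pdX {n : ℕ} (k i : Fin n) (x : En n) :
    ev (MvPolynomial.pderiv i (MvPolynomial.X k)) x = if i = k then 1 else 0 := by
  by_cases h : i = k
  · subst h; simp [ev]
  · simp [ev, MvPolynomial.pderiv_X_of_ne (Ne.symm h), h]

theorem Lop_barr {n : ℕ} [NeZero n] {B : Fin n → Fin n → ℝ} {lam : ℝ} (hB : EllB n B lam)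
    (ω R : ℝ) (x : En n) : ev (Lop B (barr B ω R)) x = - (2 * ω / R ^ 2) := by
  have h0 := trB_pos hB 0
  have e : ev (Lop B (barr B ω R)) x = (ω / R ^ 2) * ev (Lop B (sqd 0)) x +
    (ω * ((∑ i, B i i + 1) / B 0 0) / R) * ev (Lop B (MvPolynomial.X 0)) x
    - (ω * ((∑ i, B i i + 1) / B 0 0) / R ^ 2) *
      ev (Lop B (MvPolynomial.X 0 * MvPolynomial.X 0)) x := by
    simp [barr, ev, MvPolynomial.smul_eval]
  have g : Gam B (MvPolynomial.X 0) (MvPolynomial.X 0) x = B 0 0 := by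
    simp only [Gam, ev_pdX]
    simp
  rw [e, ev_Lop_sqd, ev_Lop_mul hB.symm, Lop_X, g]
  field_simp
  ring

theorem barrier {n : ℕ} [NeZero n] {B : Fin n → Fin n → ℝ} {lam : ℝ} (hB : EllB n B lam)
    {v : En n → ℝ} {M : ℝ} {Ω : Set (En n)} (hv : Sol B v M Ω) (τ : En n) {ω R : ℝ} (hω : 0 < ω)
    (hR : 0 < R) (hW : ∀ x ∈ closedBall (0 : En n) R, 2 * v x - v (x + τ) - v (x - τ) ≤ ω)
    (x : En n) (hx : x ∈ closedBall (0 : En n) R) (hx0 : 0 ≤ x 0) :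
    2 * v x - v (x + τ) - v (x - τ) ≤ ev (barr B ω R) x := by
  by_contra hcon
  push Not at hcon
  have h00 := trB_pos hB 0
  have hT := tr_pos hB
  have hc0 : Continuous fun y : En n => y 0 := by fun_prop
  have hcv := hv.cont
  have hcp : Continuous fun y : En n => v (y + τ) := hcv.comp (by fun_prop)
  have hcm : Continuous fun y : En n => v (y - τ) := hcv.comp (by fun_prop)
  have hcf : Continuous fun y : En n => 2 * v y - v (y + τ) - v (y - τ) - ev (barr B ω R) y :=
    (((continuous_const.mul hcv).sub hcp).sub hcm).sub (ev_cont _)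
  have hcomp : IsCompact (closedBall (0 : En n) R ∩ {y : En n | 0 ≤ y 0}) :=
    (isCompact_closedBall _ _).inter_right (isClosed_le continuous_const hc0)
  obtain ⟨z, ⟨hzR, hz0⟩, hzmax⟩ := hcomp.exists_isMaxOn ⟨x, hx, hx0⟩ hcf.continuousOn
  have hzx := hzmax ⟨hx, hx0⟩
  simp only [mem_setOf_eq] at hzx hz0
  have hpos : ev (barr B ω R) z < 2 * v z - v (z + τ) - v (z - τ) := by linarith
  have hzn : ‖z‖ ≤ R := by simpa using hzR
  have hzz : z 0 ≤ R := (le_abs_self _).trans ((PiLp.norm_apply_le z 0).trans hzn)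
  have hvp := hv.nonneg (z + τ)
  have hvm := hv.nonneg (z - τ)
  set K := (∑ i, B i i + 1) / B 0 0 with hK
  have hK0 : 0 < K := by positivity
  have hq : ω / R ^ 2 * ‖z‖ ^ 2 ≤ ev (barr B ω R) z := by
    rw [ev_barr, ← hK]
    have : (ω * K / R) * z 0 - (ω * K / R ^ 2) * (z 0 * z 0) = ω * K / R ^ 2 * (z 0 * (R - z 0)) := by
      field_simp
    have h2 : 0 ≤ ω * K / R ^ 2 * (z 0 * (R - z 0)) :=
      mul_nonneg (by positivity) (mul_nonneg hz0 (by linarith))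
    linarith
  have hq0 : 0 ≤ ω / R ^ 2 * ‖z‖ ^ 2 := by positivity
  have hvz : 0 < v z := by linarith
  have hz0' : 0 < z 0 := by
    by_contra h
    rw [hv.zero z (not_lt.1 h)] at hvz
    exact lt_irrefl _ hvz
  have hzR' : ‖z‖ < R := by
    refine lt_of_le_of_ne hzn fun h => ?_
    have h2 := hW z hzR
    rw [h, div_mul_cancel₀ _ (by positivity)] at hq
    linarith
  have hopen : IsOpen (Ω ∩ (ball (0 : En n) R ∩ {y : En n | 0 < y 0})) :=
    hv.op.inter (isOpen_ball.inter (isOpen_lt continuous_const hc0))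
  obtain ⟨r, hr, hrs⟩ := Metric.nhds_basis_closedBall.mem_iff.1
    (hopen.mem_nhds ⟨hv.pos z hvz, by simpa using hzR', hz0'⟩)
  refine local_contra hB hcv hcp hcm hr (fun y hy => hv.sub1 y (hrs (ball_subset_closedBall hy)).1)
    (fun y _ => subAt_trans (hv.sup1 (y + τ)))
    (fun y _ => ?_) (barr B ω R) (κ := 2 * ω / R ^ 2) (by positivity) (Lop_barr hB ω R)
    (fun y hy => ?_)
  · have := subAt_trans (x₀ := y) (τ := -τ) (hv.sup1 (y + -τ))
    simpa only [← sub_eq_add_neg] using this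
  · obtain ⟨_, h2, h3⟩ := hrs hy
    exact hzmax ⟨ball_subset_closedBall h2, (show (0:ℝ) < y 0 from h3).le⟩

theorem convexW {n : ℕ} [NeZero n] {B : Fin n → Fin n → ℝ} {lam : ℝ} (hB : EllB n B lam)
    {v : En n → ℝ} {M : ℝ} (hM : 0 < M) {Ω : Set (En n)} (hv : Sol B v M Ω) (x τ : En n) :
    2 * v x - v (x + τ) - v (x - τ) ≤ 0 := by
  rcases le_or_gt (x 0) 0 with h | h
  · rw [hv.zero x h]; linarith [hv.nonneg (x + τ), hv.nonneg (x - τ)]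
  obtain ⟨C, hC, hCW⟩ := growthW hB hM hv τ
  have h00 := trB_pos hB 0
  have hT := tr_pos hB
  set K := (∑ i, B i i + 1) / B 0 0 with hK
  have hK0 : 0 < K := by positivity
  set D := C * ‖x‖ ^ 2 + C * K * x 0 with hD
  have hD0 : 0 ≤ D := by positivity
  by_contra hcon
  push Not at hcon
  set w := 2 * v x - v (x + τ) - v (x - τ) with hw
  set ρ := 1 + 4 * ‖τ‖ + ‖x‖ + D / w with hρ
  clear_value ρ w
  have hDw : 0 ≤ D / w := by positivity
  have hρ1 : 1 ≤ ρ := by linarith [norm_nonneg τ, norm_nonneg x]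
  have hρ2 : 4 * ‖τ‖ ≤ ρ := by linarith [norm_nonneg τ, norm_nonneg x]
  have hρ0 : 0 < ρ := by linarith
  have hρx : ‖x‖ ≤ ρ ^ 3 := by
    have : ρ ≤ ρ ^ 3 := by nlinarith [sq_nonneg ρ]
    linarith [norm_nonneg τ, norm_nonneg x]
  have := barrier hB hv τ (ω := C * ρ ^ 2) (R := ρ ^ 3) (by positivity) (by positivity)
    (fun y hy => hCW ρ hρ1 hρ2 y (by simpa using hy)) x (by simpa using hρx) h.le
  rw [ev_barr, ← hK, ← hw] at this
  have e1 : C * ρ ^ 2 / (ρ ^ 3) ^ 2 * ‖x‖ ^ 2 ≤ C * ‖x‖ ^ 2 / ρ := by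
    rw [div_mul_eq_mul_div, div_le_div_iff₀ (by positivity) (by positivity)]
    have : ρ ^ 3 ≤ ρ ^ 6 := pow_le_pow_right₀ hρ1 (by norm_num)
    have h2 : C * ‖x‖ ^ 2 * ρ ^ 3 ≤ C * ‖x‖ ^ 2 * ρ ^ 6 := by gcongr
    calc C * ρ ^ 2 * ‖x‖ ^ 2 * ρ = C * ‖x‖ ^ 2 * ρ ^ 3 := by ring
      _ ≤ C * ‖x‖ ^ 2 * ρ ^ 6 := h2
      _ = _ := by ring
  have e2 : C * ρ ^ 2 * K / ρ ^ 3 * x 0 = C * K * x 0 / ρ := by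
    field_simp
  have e3 : 0 ≤ C * ρ ^ 2 * K / (ρ ^ 3) ^ 2 * (x 0 * x 0) := by positivity
  have e4 : w ≤ D / ρ := by
    rw [hD, add_div]; linarith
  rw [le_div_iff₀ hρ0] at e4
  have e5 : D / w < ρ := by linarith [norm_nonneg τ, norm_nonneg x]
  rw [div_lt_iff₀ hcon] at e5
  linarith

theorem F_lin {n : ℕ} {lam Lam : ℝ} {F : Matrix (Fin n) (Fin n) ℝ → ℝ} (hF : EllipticF n lam Lam F) :
    ∃ D : Matrix (Fin n) (Fin n) ℝ →L[ℝ] ℝ, ∀ A, F A = D A := by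
  have hd : DifferentiableAt ℝ F 0 := hF.smoothF.differentiable (by norm_num) 0
  refine ⟨fderiv ℝ F 0, fun A => ?_⟩
  have h1 : HasDerivAt (fun t : ℝ => t • A) A 0 := by
    have h := (hasDerivAt_id (0:ℝ)).smul_const A
    rw [one_smul] at h
    exact h
  have h0 : HasFDerivAt F (fderiv ℝ F 0) ((fun t : ℝ => t • A) 0) := by
    simpa using hd.hasFDerivAt
  have h2 : HasDerivAt (F ∘ fun t : ℝ => t • A) (fderiv ℝ F 0 A) 0 := h0.comp_hasDerivAt 0 h1
  have h3 : (F ∘ fun t : ℝ => t • A) = fun t : ℝ => t * F A := by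
    funext t; exact hF.homogeneous t A
  rw [h3] at h2
  have h4 : HasDerivAt (fun t : ℝ => t * F A) (F A) 0 := by
    simpa using (hasDerivAt_id (0:ℝ)).mul_const (F A)
  exact h4.unique h2

def BF {n : ℕ} (F : Matrix (Fin n) (Fin n) ℝ → ℝ) (i j : Fin n) : ℝ :=
  (F (Matrix.single i j 1) + F (Matrix.single j i 1)) / 2

theorem BF_eq {n : ℕ} {lam Lam : ℝ} {F : Matrix (Fin n) (Fin n) ℝ → ℝ} (hF : EllipticF n lam Lam F)
    (A : Matrix (Fin n) (Fin n) ℝ) (hA : A.IsSymm) : ∑ i, ∑ j, BF F i j * A i j = F A := by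
  obtain ⟨D, hD⟩ := F_lin hF
  have h1 : F A = ∑ i, ∑ j, A i j * F (Matrix.single i j 1) := by
    rw [hD]
    conv_lhs => rw [Matrix.matrix_eq_sum_single A]
    rw [map_sum]
    refine Finset.sum_congr rfl fun i _ => ?_
    rw [map_sum]
    refine Finset.sum_congr rfl fun j _ => ?_
    rw [hD, ← smul_eq_mul, ← map_smul, Matrix.smul_single, smul_eq_mul, mul_one]
  have h2 : F A = ∑ i, ∑ j, A i j * F (Matrix.single j i 1) := by
    rw [h1, Finset.sum_comm]
    refine Finset.sum_congr rfl fun i _ => Finset.sum_congr rfl fun j _ => ?_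
    rw [hA.apply]
  have h3 : F A = (F A + F A) / 2 := by ring
  rw [h3]
  nth_rewrite 2 [h2]
  rw [h1]
  simp only [← Finset.sum_add_distrib, Finset.sum_div, BF]
  refine Finset.sum_congr rfl fun i _ => Finset.sum_congr rfl fun j _ => ?_
  ring

theorem opnorm_lower {n : ℕ} (v : Fin n → ℝ) :
    ∑ i, v i ^ 2 ≤ matOpNorm (Matrix.vecMulVec v v) := by
  set w : En n := WithLp.toLp 2 v with hw
  have hn : ‖w‖ ^ 2 = ∑ i, v i ^ 2 := by rw [nsq]
  rw [← hn]
  rcases eq_or_ne w 0 with h | h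
  · rw [h]; simp [matOpNorm]
  have hp : 0 < ‖w‖ := norm_pos_iff.2 h
  have h1 := (Matrix.toEuclideanCLM (𝕜 := ℝ) (Matrix.vecMulVec v v) :
    EuclideanSpace ℝ (Fin n) →L[ℝ] EuclideanSpace ℝ (Fin n)).le_opNorm w
  have h2 : (Matrix.toEuclideanCLM (𝕜 := ℝ) (Matrix.vecMulVec v v) :
    EuclideanSpace ℝ (Fin n) →L[ℝ] EuclideanSpace ℝ (Fin n)) w = (‖w‖ ^ 2) • w := by
    ext i
    rw [hn]
    simp only [hw, Matrix.toEuclideanCLM_toLp, PiLp.smul_apply, smul_eq_mul, Matrix.mulVec,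
      dotProduct, Matrix.vecMulVec_apply, Finset.sum_mul]
    refine Finset.sum_congr rfl fun j _ => ?_
    ring
  rw [h2, norm_smul, Real.norm_eq_abs, abs_of_nonneg (by positivity)] at h1
  exact le_of_mul_le_mul_right h1 hp

theorem BF_ell {n : ℕ} {lam Lam : ℝ} {F : Matrix (Fin n) (Fin n) ℝ → ℝ} (hF : EllipticF n lam Lam F) :
    EllB n (BF F) lam := by
  have hlow : ∀ A : Matrix (Fin n) (Fin n) ℝ, A.PosSemidef → 
      lam * matOpNorm A ≤ ∑ i, ∑ j, BF F i j * A i j := by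
    intro A hA
    have hs : A.IsSymm := by
      have := hA.1
      rwa [Matrix.IsHermitian, Matrix.conjTranspose_eq_transpose_of_trivial] at this
    have h := hF.elliptic_lower 0 A (by simp [Matrix.IsSymm]) hA
    have h0 : F 0 = 0 := by
      have := hF.homogeneous 0 0
      simpa using this
    rw [zero_add, h0, sub_zero] at h
    rwa [BF_eq hF A hs]
  refine ⟨fun i j => ?_, hF.lam_pos, fun v => ?_, fun A hA => ?_⟩
  · simp only [BF]; ring
  · have hps : (Matrix.vecMulVec v v).PosSemidef := by
      simpa using Matrix.posSemidef_vecMulVec_self_star v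
    refine (mul_le_mul_of_nonneg_left (opnorm_lower v) hF.lam_pos.le).trans ?_
    exact hlow _ hps
  · exact (mul_nonneg hF.lam_pos.le (norm_nonneg _)).trans (hlow A hA)

theorem sup_bdry {n : ℕ} [NeZero n] {B : Fin n → Fin n → ℝ} {lam : ℝ} (hB : EllB n B lam)
    (x₀ : En n) (v : En n → ℝ) (hv : ∀ x : En n, x 0 ≤ 0 → v x = 0) (hx : x₀ 0 ≤ 0)
    (hd : HasFDerivAt v (0 : En n →L[ℝ] ℝ) x₀) : SubAt B (fun y => - v y) 0 x₀ := by
  intro c b A hA hmax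
  apply hB.mono
  have hmin : ∀ᶠ x in nhds x₀, quadPoly c b A x₀ ≤ quadPoly c b A x + v x := by
    filter_upwards [hmax] with x hx'
    simp only [hv x₀ hx] at hx'
    linarith
  have hline : ∀ y : En n, ∀ᶠ t in nhds (0:ℝ), quadPoly c b A x₀ ≤
      quadPoly c b A (x₀ + t • y) + v (x₀ + t • y) := by
    intro y
    have hc : Continuous fun t : ℝ => x₀ + t • y := by fun_prop
    have := hc.tendsto 0
    simp only [zero_smul, add_zero] at this
    exact this.eventually hmin
  apply psd_of_localmin c b A hA x₀
  · intro y
    obtain ⟨s, hs, h⟩ := Metric.eventually_nhds_iff.1 (hline y)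
    refine ⟨s, hs, fun t ht hts => ?_⟩
    rcases le_total (y 0) 0 with hy | hy
    · left
      have := @h t (by simpa [abs_of_pos ht] using hts)
      rw [hv (x₀ + t • y)] at this
      · linarith
      · simp only [PiLp.add_apply, PiLp.smul_apply, smul_eq_mul]; nlinarith
    · right
      have := @h (-t) (by simpa [abs_of_pos ht] using hts)
      rw [neg_smul, ← sub_eq_add_neg, hv (x₀ - t • y)] at this
      · linarith
      · simp only [PiLp.sub_apply, PiLp.smul_apply, smul_eq_mul]; nlinarith
  · intro y
    set f : ℝ → ℝ := fun t => quadPoly c b A (x₀ + t • y) + v (x₀ + t • y) with hf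
    have hmin0 : IsLocalMin f 0 := by
      filter_upwards [hline y] with t ht
      simpa [hf, hv x₀ hx] using ht
    set g := ∑ i, b i * y i + ∑ i, ∑ j, A i j * x₀ i * y j with hg
    have hfe : f = fun t => quadPoly c b A x₀ + t * g + t ^ 2 * (1/2 * ∑ i, ∑ j, A i j * y i * y j)
        + v (x₀ + t • y) := by
      funext t
      simp only [hf]
      rw [quad_line c b A hA x₀ y t]
    have hd' : HasDerivAt f g 0 := by
      rw [hfe]
      have h1 : HasDerivAt (fun t : ℝ => t * g) (1 * g) 0 := (hasDerivAt_id (0:ℝ)).mul_const g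
      have h2 := ((hasDerivAt_pow 2 (0:ℝ)).mul_const (1/2 * ∑ i, ∑ j, A i j * y i * y j))
      have h3 : HasDerivAt (fun t : ℝ => x₀ + t • y) y 0 := by
        simpa using ((hasDerivAt_id (0:ℝ)).smul_const y).const_add x₀
      have h4 : HasFDerivAt v (0 : En n →L[ℝ] ℝ) ((fun t : ℝ => x₀ + t • y) 0) := by simpa using hd
      have h5 := h4.comp_hasDerivAt 0 h3
      have := ((h1.const_add (quadPoly c b A x₀)).add h2).add h5
      refine this.congr_deriv ?_
      simp
    exact hmin0.hasDerivAt_eq_zero hd'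

theorem mk_sol {n : ℕ} [NeZero n] {lam Lam : ℝ}
    {F : Matrix (Fin n) (Fin n) ℝ → ℝ} (hF : EllipticF n lam Lam F)
    {M : ℝ} (hM : 0 < M) {u : En n → ℝ} {Ω : Set (En n)} (hu : MemPinf F M u Ω)
    (hnonneg : ∀ x ∈ HplusSet n, 0 ≤ u x)
    (hgrad : ∀ x ∈ PiSet n, HasGradientWithinAt u 0 (HcloSet n) x) :
    Sol (BF F) (fun x => if 0 < x 0 then u x else 0) M Ω := by
  have hB := BF_ell hF
  set v : En n → ℝ := fun x => if 0 < x 0 then u x else 0 with hvd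
  have hvp : ∀ x : En n, 0 < x 0 → v x = u x := fun x hx => by simp [hvd, hx]
  have hvz : ∀ x : En n, x 0 ≤ 0 → v x = 0 := fun x hx => by simp [hvd, not_lt.2 hx]
  have hvc : ∀ x ∈ HcloSet n, v x = u x := by
    intro x hx
    rcases (show (0:ℝ) ≤ x 0 from hx).lt_or_eq with h | h
    · exact hvp x h
    · rw [hvz x h.ge, hu.bdry_zero x h.symm]
  have hc0 : Continuous fun y : En n => y 0 := by fun_prop
  have hcl1 : IsClosed (HcloSet n) := isClosed_le continuous_const hc0
  have hcl2 : IsClosed {x : En n | x 0 ≤ 0} := isClosed_le hc0 continuous_const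
  have huniv : HcloSet n ∪ {x : En n | x 0 ≤ 0} = univ := by
    ext x; simpa [HcloSet] using le_total 0 (x 0)
  have hopen : IsOpen (HplusSet n) := isOpen_lt continuous_const hc0
  have hcont : Continuous v := by
    rw [← continuousOn_univ, ← huniv]
    refine ContinuousOn.union_of_isClosed (hu.cont.congr hvc) ?_ hcl1 hcl2
    exact continuousOn_const.congr (fun x hx => hvz x hx)
  have hnn : ∀ x, 0 ≤ v x := by
    intro x
    rcases lt_or_ge 0 (x 0) with h | h
    · rw [hvp x h]; exact hnonneg x h
    · rw [hvz x h]
  have hsubI : ∀ x ∈ HplusSet n, SubAt (BF F) v (Ω.indicator (fun _ => (1:ℝ)) x) x := by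
    intro x hx c b A hA hm
    rw [BF_eq hF A hA]
    refine (hu.sol x hx).1 c b A hA ?_
    filter_upwards [hm.filter_mono nhdsWithin_le_nhds, self_mem_nhdsWithin] with y hy hy'
    rwa [hvp y hy', hvp x hx] at hy
  refine ⟨hcont, hnn, hvz, fun x => ?_, fun x => ?_, fun x => ?_, hu.Ω_open, fun x hx => ?_,
    fun x hx => ?_⟩
  · rcases lt_or_ge 0 (x 0) with h | h
    · rw [hvp x h]; exact (le_abs_self _).trans (hu.growth x)
    · rw [hvz x h]; positivity
  · rcases lt_or_ge 0 (x 0) with h | h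
    · intro c b A hA hm
      refine le_trans ?_ (hsubI x h c b A hA hm)
      exact indicator_nonneg (fun _ _ => zero_le_one) x
    · exact subAt_zero hB x v hnn (hvz x h)
  · rcases lt_or_ge 0 (x 0) with h | h
    · intro c b A hA hm
      have hneg : ∀ y : En n, quadPoly (-c) (-b) (-A) y = - quadPoly c b A y := by
        intro y; simp [quadPoly]; ring
      have := (hu.sol x h).2 (-c) (-b) (-A) hA.neg (by
        filter_upwards [hm.filter_mono nhdsWithin_le_nhds, self_mem_nhdsWithin] with y hy hy'
        rw [hvp y hy', hvp x h] at hy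
        rw [hneg, hneg]
        linarith)
      rw [← BF_eq hF (-A) hA.neg] at this
      have h1 : Ω.indicator (fun _ => (1:ℝ)) x ≤ 1 := indicator_le_self' (fun _ _ => zero_le_one) x
      have h2 : ∑ i, ∑ j, BF F i j * (-A) i j = - ∑ i, ∑ j, BF F i j * A i j := by
        simp
      linarith
    · have hd : HasFDerivAt v (0 : En n →L[ℝ] ℝ) x := by
        have d2 : HasFDerivWithinAt v (0 : En n →L[ℝ] ℝ) {x : En n | x 0 ≤ 0} x :=
          (hasFDerivWithinAt_const (0:ℝ) x _).congr (fun y hy => hvz y hy) (hvz x h)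
        have d1 : HasFDerivWithinAt v (0 : En n →L[ℝ] ℝ) (HcloSet n) x := by
          rcases h.lt_or_eq with h' | h'
          · exact HasFDerivWithinAt.of_notMem_closure (by
              rw [hcl1.closure_eq]; simpa [HcloSet] using h')
          · have := (hgrad x h').hasFDerivWithinAt
            rw [map_zero] at this
            exact this.congr hvc (hvc x h'.ge)
        have := d1.union d2
        rwa [huniv, hasFDerivWithinAt_univ] at this
      intro c b A hA hm
      have := sup_bdry hB x v hvz h hd c b A hA hm
      linarith
  · by_contra hn
    have h : 0 < x 0 := by
      by_contra h
      rw [hvz x (not_lt.1 h)] at hx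
      exact lt_irrefl _ hx
    rw [hvp x h, (hu.vanish x ⟨h, hn⟩).1] at hx
    exact lt_irrefl _ hx
  · have := hsubI x (hu.Ω_sub hx)
    rwa [indicator_of_mem hx] at this

/-- **Theorem B** (classification of nonnegative global solutions): if `u ∈ P_∞⁺(0,M)`,
`u ≥ 0` and `∇u = 0` on `Π`, then the coincidence set `Λ(u)` equals `Π`. -/
theorem theoremB (n : ℕ) [NeZero n] (hn : 2 ≤ n) (lam Lam : ℝ)
    (F : Matrix (Fin n) (Fin n) ℝ → ℝ) (hF : EllipticF n lam Lam F)
    (M : ℝ) (hM : 0 < M) (u : En n → ℝ) (Ω : Set (En n)) (hu : MemPinf F M u Ω)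
    (hnonneg : ∀ x ∈ HplusSet n, 0 ≤ u x)
    (hgrad : ∀ x ∈ PiSet n, HasGradientWithinAt u 0 (HcloSet n) x) :
    {x | x ∈ HcloSet n ∧ u x = 0 ∧ HasGradientWithinAt u 0 (HcloSet n) x} = PiSet n := by
  have hB := BF_ell hF
  have hS := mk_sol hF hM hu hnonneg hgrad
  set v : En n → ℝ := fun x => if 0 < x 0 then u x else 0 with hvd
  ext p
  constructor
  · rintro ⟨hp, hup, -⟩
    by_contra hne
    have hp0 : 0 < p 0 := lt_of_le_of_ne hp (Ne.symm hne)
    have hvp : v p = 0 := by simp [hvd, hup]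
    have hz : ∀ x : En n, x 0 ≤ p 0 / 2 → v x = 0 := by
      intro x hx
      have h1 := convexW hB hM hS x (p - x)
      rw [add_sub_cancel, hvp, hS.zero (x - (p - x))] at h1
      · linarith [hS.nonneg x]
      · simp only [PiLp.sub_apply]; linarith
    have hc0 : Continuous fun y : En n => y 0 := by fun_prop
    have hop : IsOpen {x : En n | x 0 < p 0 / 2} := isOpen_lt hc0 continuous_const
    obtain ⟨y, hy, hyΩ⟩ := mem_closure_iff.1 hu.zero_bdry.1 _ hop
      (show (0 : En n) 0 < p 0 / 2 by simpa using hp0)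
    have := hS.sub1 y hyΩ 0 0 0 (by simp [Matrix.IsSymm]) (by
      filter_upwards [hop.mem_nhds hy] with z hz'
      rw [hz z (le_of_lt hz'), hz y (le_of_lt hy)]
      simp [quadPoly])
    simp at this
    linarith
  · intro hp
    exact ⟨(show p 0 = 0 from hp).ge, hu.bdry_zero p hp, hgrad p hp⟩
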